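/- arXiv:1904.06035 — 3 statements merged into one kernel-verified Lean document; each statement's English description precedes it below -/
import Mathlib

section
/- Let (R, 𝔪) be a complete Noetherian local Cohen–Macaulay ring that is a k-algebra with residue field k (k a field), and let M, N be maximal Cohen–Macaulay R-modules. For all maximal Cohen–Macaulay R-modules A ∈ K_CM(M) and B ∈ K_CM(N), the module A ⊕ B belongs to K_CM(M ⊕ N). -/
open Polynomial TensorProduct

noncomputable section

/-- The prime ideal `(t)` of the polynomial ring `k[t]`. -/
def tIdeal (k : Type) [Field k] : Ideal (Polynomial k) := Ideal.span {Polynomial.X}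

instance tIdeal_isPrime (k : Type) [Field k] : (tIdeal k).IsPrime := by
  have h : tIdeal k = RingHom.ker (Polynomial.evalRingHom (0 : k)) := by
    rw [Polynomial.ker_evalRingHom]
    simp [tIdeal]
  rw [h]
  exact RingHom.ker_isPrime _

/-- `V = k[t]_{(t)}`, the localization of the polynomial ring `k[t]` at the prime ideal `(t)`. -/
def DegV (k : Type) [Field k] : Type := Localization.AtPrime (tIdeal k)

instance (k : Type) [Field k] : CommRing (DegV k) :=
  inferInstanceAs (CommRing (Localization.AtPrime (tIdeal k)))

instance (k : Type) [Field k] : Algebra (Polynomial k) (DegV k) :=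
  inferInstanceAs (Algebra (Polynomial k) (Localization.AtPrime (tIdeal k)))

instance (k : Type) [Field k] : Algebra k (DegV k) :=
  inferInstanceAs (Algebra k (Localization.AtPrime (tIdeal k)))

instance (k : Type) [Field k] : IsScalarTower k (Polynomial k) (DegV k) :=
  inferInstanceAs (IsScalarTower k (Polynomial k) (Localization.AtPrime (tIdeal k)))

/-- The element `t` of `V = k[t]_{(t)}`. -/
def degT (k : Type) [Field k] : DegV k := algebraMap (Polynomial k) (DegV k) Polynomial.X

/-- `K = V[t⁻¹]`, which is the fraction field `k(t)` of `V = k[t]_{(t)}`. -/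
def DegK (k : Type) [Field k] : Type := Localization (Submonoid.powers (degT k))

instance (k : Type) [Field k] : CommRing (DegK k) :=
  inferInstanceAs (CommRing (Localization (Submonoid.powers (degT k))))

instance (k : Type) [Field k] : Algebra (DegV k) (DegK k) :=
  inferInstanceAs (Algebra (DegV k) (Localization (Submonoid.powers (degT k))))

instance (k : Type) [Field k] : Algebra k (DegK k) :=
  inferInstanceAs (Algebra k (Localization (Submonoid.powers (degT k))))

/-- The localized module `Q[t⁻¹]` is a module over `K = V[t⁻¹]`. -/
instance (k : Type) [Field k] (Q : Type) [AddCommGroup Q] [Module (DegV k) Q] :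
    Module (DegK k) (LocalizedModule (Submonoid.powers (degT k)) Q) :=
  inferInstanceAs (Module (Localization (Submonoid.powers (degT k)))
    (LocalizedModule (Submonoid.powers (degT k)) Q))

section

variable (k : Type) [Field k] (R : Type) [Ring R] [Algebra k R]

/-- `1 ⊗ t` is central in `R ⊗[k] V`. -/
theorem degT_central (x : R ⊗[k] DegV k) :
    x * ((1 : R) ⊗ₜ[k] degT k) = ((1 : R) ⊗ₜ[k] degT k) * x := by
  induction x with
  | zero => simp
  | tmul a v => simp [Algebra.TensorProduct.tmul_mul_tmul, mul_comm]
  | add x y hx hy => simp [add_mul, mul_add, hx, hy]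

/-- Multiplication by `1 ⊗ t` on an `R ⊗[k] V`-module, as an `R ⊗[k] V`-linear map. -/
def tSmul (Q : Type) [AddCommGroup Q] [Module (R ⊗[k] DegV k) Q] :
    Q →ₗ[R ⊗[k] DegV k] Q where
  toFun q := ((1 : R) ⊗ₜ[k] degT k) • q
  map_add' := smul_add _
  map_smul' x q := by
    simp only [RingHom.id_apply, ← mul_smul, degT_central]

/-- The `R`-module structure on an `R ⊗[k] V`-module obtained by restriction of scalars
along `R → R ⊗[k] V`. -/
def rRestrict (Q : Type) [AddCommGroup Q] [Module (R ⊗[k] DegV k) Q] : Module R Q :=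
  Module.compHom Q (Algebra.TensorProduct.includeLeftRingHom : R →+* R ⊗[k] DegV k)

/-- The `V`-module structure on an `R ⊗[k] V`-module obtained by restriction of scalars
along `V → R ⊗[k] V`. -/
def vRestrict (Q : Type) [AddCommGroup Q] [Module (R ⊗[k] DegV k) Q] : Module (DegV k) Q :=
  Module.compHom Q
    ((Algebra.TensorProduct.includeRight : DegV k →ₐ[k] R ⊗[k] DegV k) : DegV k →+* R ⊗[k] DegV k)

/-- The action of `r : R` on an `R ⊗[k] V`-module `Q`, as a `V`-linear endomorphism of `Q`. -/
def rAct (Q : Type) [AddCommGroup Q] [Module (R ⊗[k] DegV k) Q] (r : R) :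
    letI := vRestrict k R Q
    Q →ₗ[DegV k] Q :=
  letI := vRestrict k R Q
  { toFun := fun q => (r ⊗ₜ[k] (1 : DegV k)) • q
    map_add' := smul_add _
    map_smul' := fun v q => by
      show (r ⊗ₜ[k] (1 : DegV k)) • (((1 : R) ⊗ₜ[k] v) • q)
        = ((1 : R) ⊗ₜ[k] v) • ((r ⊗ₜ[k] (1 : DegV k)) • q)
      rw [← mul_smul, ← mul_smul, Algebra.TensorProduct.tmul_mul_tmul,
        Algebra.TensorProduct.tmul_mul_tmul, one_mul, mul_one, one_mul, mul_one] }

/-- The action of `r : R` on a module `M`, as a `k`-linear endomorphism of `M`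
(where `M` is viewed as a `k`-module by restriction of scalars along `k → R`). -/
def rActK (M : Type) [AddCommGroup M] [Module R M] (r : R) :
    letI := Module.compHom M (algebraMap k R)
    M →ₗ[k] M :=
  letI := Module.compHom M (algebraMap k R)
  { toFun := fun m => r • m
    map_add' := smul_add r
    map_smul' := fun c m => by
      show r • ((algebraMap k R c) • m) = (algebraMap k R c) • (r • m)
      rw [← mul_smul, ← mul_smul, Algebra.commutes] }

/-- Degeneration of modules (Yoshino): `M ⇒_deg N` iff there is a finitely generated
`R ⊗[k] V`-module `Q`, flat over `V`, with `Q/tQ ≅ N` as `R`-modules and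
`Q_t = Q[t⁻¹] ≅ M ⊗[k] K` compatibly with the `R`- and `K`-actions
(i.e. as `R ⊗[k] K`-modules). -/
def Degenerates (M N : Type) [AddCommGroup M] [Module R M] [AddCommGroup N] [Module R N] :
    Prop :=
  ∃ (Q : Type) (_ : AddCommGroup Q) (_ : Module (R ⊗[k] DegV k) Q),
    Module.Finite (R ⊗[k] DegV k) Q ∧
    (letI := vRestrict k R Q; Module.Flat (DegV k) Q) ∧
    -- `Q/tQ ≅ N` as `R`-modules
    (letI := rRestrict k R (Q ⧸ LinearMap.range (tSmul k R Q))
     Nonempty ((Q ⧸ LinearMap.range (tSmul k R Q)) ≃ₗ[R] N)) ∧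
    -- `Q_t ≅ M ⊗_k K` as `R ⊗_k K`-modules, i.e. compatibly with both actions
    (letI := vRestrict k R Q
     letI : Module k M := Module.compHom M (algebraMap k R)
     ∃ f : LocalizedModule (Submonoid.powers (degT k)) Q ≃+ (M ⊗[k] DegK k),
       (∀ (c : DegK k) (x : LocalizedModule (Submonoid.powers (degT k)) Q),
          f (c • x) = LinearMap.lTensor M (LinearMap.mulLeft k c) (f x)) ∧
       (∀ (r : R) (x : LocalizedModule (Submonoid.powers (degT k)) Q),
          f (LocalizedModule.map (Submonoid.powers (degT k)) (rAct k R Q r) x)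
            = LinearMap.rTensor (DegK k) (rActK k R M r) (f x)))

end

/-- The depth of a module `M` over a local ring `R`: the supremum of the lengths of
`M`-regular sequences consisting of elements of the maximal ideal. -/
noncomputable def moduleDepth (R : Type) [CommRing R] [IsLocalRing R]
    (M : Type) [AddCommGroup M] [Module R M] : ℕ∞ :=
  sSup {n : ℕ∞ | ∃ rs : List R, (rs.length : ℕ∞) = n ∧
    (∀ r ∈ rs, r ∈ IsLocalRing.maximalIdeal R) ∧ RingTheory.Sequence.IsRegular M rs}

/-- A module `M` over a local ring `R` is maximal Cohen–Macaulay if `depth M = dim R`. -/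
def IsMCM (R : Type) [CommRing R] [IsLocalRing R]
    (M : Type) [AddCommGroup M] [Module R M] : Prop :=
  (moduleDepth R M : WithBot ℕ∞) = ringKrullDim R

/-- A local ring `R` is Cohen–Macaulay if `depth R = dim R`. -/
def IsCMLocalRing (R : Type) [CommRing R] [IsLocalRing R] : Prop :=
  (moduleDepth R R : WithBot ℕ∞) = ringKrullDim R

/-- A bundled finitely generated (left) `R`-module. -/
structure FGMod (R : Type) [Ring R] where
  carrier : Type
  [addCommGroup : AddCommGroup carrier]
  [module : Module R carrier]
  [finite : Module.Finite R carrier]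

attribute [instance] FGMod.addCommGroup FGMod.module FGMod.finite

/-- The operator `𝒞` on sets of finitely generated `R`-modules:
`𝒞(𝒳)` consists of the f.g. modules `N` such that `M^{⊕n} ⇒_deg N^{⊕n}`
for some `M ∈ 𝒳` and some `n > 0`. -/
def CC (k : Type) [Field k] (R : Type) [Ring R] [Algebra k R] (X : Set (FGMod R)) :
    Set (FGMod R) :=
  {N | ∃ M ∈ X, ∃ n : ℕ, 0 < n ∧
    Degenerates k R (Fin n → M.carrier) (Fin n → N.carrier)}

/-- `K_CM(𝒳) = 𝒞(𝒳) ∩ CM(R)`. -/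
def KCM (k : Type) [Field k] (R : Type) [CommRing R] [IsLocalRing R] [Algebra k R]
    (X : Set (FGMod R)) : Set (FGMod R) :=
  CC k R X ∩ {N | IsMCM R N.carrier}

section Helpers

set_option linter.style.haveILetI false

open CategoryTheory

theorem locMap_mk {V : Type} [CommRing V] (S : Submonoid V) {P Q : Type}
    [AddCommGroup P] [Module V P] [AddCommGroup Q] [Module V Q] (p : P →ₗ[V] Q) (q : P) (s : S) :
    LocalizedModule.map S p (LocalizedModule.mk q s) = LocalizedModule.mk (p q) s :=
  IsLocalizedModule.map_LocalizedModules S p q s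

theorem locMap_comm {V : Type} [CommRing V] (S : Submonoid V) {P Q : Type}
    [AddCommGroup P] [Module V P] [AddCommGroup Q] [Module V Q] (p : P →ₗ[V] Q)
    (a : P →ₗ[V] P) (b : Q →ₗ[V] Q) (h : ∀ x, p (a x) = b (p x)) (x : LocalizedModule S P) :
    LocalizedModule.map S p (LocalizedModule.map S a x) =
      LocalizedModule.map S b (LocalizedModule.map S p x) := by
  induction x using LocalizedModule.induction_on with
  | h q s => simp only [locMap_mk, h]

theorem locProd_bijective {V : Type} [CommRing V] (S : Submonoid V) {P Q₁ Q₂ : Type}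
    [AddCommGroup P] [Module V P] [AddCommGroup Q₁] [Module V Q₁] [AddCommGroup Q₂] [Module V Q₂]
    (p₁ : P →ₗ[V] Q₁) (p₂ : P →ₗ[V] Q₂) (h : Function.Bijective (fun x => (p₁ x, p₂ x))) :
    Function.Bijective ((((LocalizedModule.map S p₁).toAddMonoidHom).prod
      (LocalizedModule.map S p₂).toAddMonoidHom)) := by
  constructor
  · rw [injective_iff_map_eq_zero]
    intro x hx
    induction x using LocalizedModule.induction_on with
    | h q s =>
      have h1 : LocalizedModule.mk (p₁ q) s = 0 := by
        rw [← locMap_mk]; exact congrArg Prod.fst hx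
      have h2 : LocalizedModule.mk (p₂ q) s = 0 := by
        rw [← locMap_mk]; exact congrArg Prod.snd hx
      rw [← LocalizedModule.zero_mk 1, LocalizedModule.mk_eq] at h1 h2
      obtain ⟨u, hu⟩ := h1
      obtain ⟨v, hv⟩ := h2
      rw [← LocalizedModule.zero_mk 1, LocalizedModule.mk_eq]
      refine ⟨u * v, ?_⟩
      simp only [one_smul, smul_zero] at hu hv ⊢
      apply h.1
      simp only [Submonoid.smul_def, map_smul, map_zero] at hu hv ⊢
      simp only [Submonoid.coe_mul]
      rw [mul_smul, mul_smul, hv, smul_comm, hu, smul_zero, smul_zero]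
  · rintro ⟨x, y⟩
    induction x using LocalizedModule.induction_on with
    | h a s =>
    induction y using LocalizedModule.induction_on with
    | h b t =>
      obtain ⟨q, hq⟩ := h.2 (t • a, s • b)
      have h1 : p₁ q = t • a := congrArg Prod.fst hq
      have h2 : p₂ q = s • b := congrArg Prod.snd hq
      refine ⟨LocalizedModule.mk q (s * t), ?_⟩
      refine Prod.ext ?_ ?_
      · show LocalizedModule.map S p₁ _ = _
        rw [locMap_mk, h1, mul_comm s t, LocalizedModule.mk_cancel_common_left]
      · show LocalizedModule.map S p₂ _ = _
        rw [locMap_mk, h2, LocalizedModule.mk_cancel_common_left]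

theorem flat_of_prod {V : Type} [CommRing V] {P Q₁ Q₂ : Type}
    [AddCommGroup P] [Module V P] [AddCommGroup Q₁] [Module V Q₁] [AddCommGroup Q₂] [Module V Q₂]
    (p₁ : P →ₗ[V] Q₁) (p₂ : P →ₗ[V] Q₂) (h : Function.Bijective (fun x => (p₁ x, p₂ x)))
    [Module.Flat V Q₁] [Module.Flat V Q₂] : Module.Flat V P := by
  have e : P ≃ₗ[V] Q₁ × Q₂ := LinearEquiv.ofBijective (p₁.prod p₂) h
  have : Module.Flat V (Q₁ × Q₂) := by
    rw [Module.Flat.iff_lTensor_preserves_injective_linearMap]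
    intro N N' _ _ _ _ f hf
    have hc : (TensorProduct.prodLeft V V Q₁ Q₂ N').toLinearMap ∘ₗ (f.lTensor (Q₁ × Q₂)) =
        ((f.lTensor Q₁).prodMap (f.lTensor Q₂)) ∘ₗ
          (TensorProduct.prodLeft V V Q₁ Q₂ N).toLinearMap := by
      apply TensorProduct.ext'
      rintro ⟨a, b⟩ n
      simp
    have h1 := Module.Flat.lTensor_preserves_injective_linearMap (M := Q₁) f hf
    have h2 := Module.Flat.lTensor_preserves_injective_linearMap (M := Q₂) f hf
    have h3 : Function.Injective (((f.lTensor Q₁).prodMap (f.lTensor Q₂)) ∘ₗ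
          (TensorProduct.prodLeft V V Q₁ Q₂ N).toLinearMap) := by
      rw [LinearMap.coe_comp, LinearMap.coe_prodMap]
      exact (h1.prodMap h2).comp (LinearEquiv.injective _)
    rw [← hc, LinearMap.coe_comp] at h3
    exact h3.of_comp
  exact Module.Flat.of_linearEquiv e

/-- Tensor products commute with binary products. -/
def tensProd {k : Type} [Field k] {P M₁ M₂ : Type} (K : Type) [AddCommGroup K] [Module k K]
    [AddCommGroup P] [Module k P] [AddCommGroup M₁] [Module k M₁] [AddCommGroup M₂] [Module k M₂]
    (p₁ : P →ₗ[k] M₁) (p₂ : P →ₗ[k] M₂) (h : Function.Bijective (fun x => (p₁ x, p₂ x))) :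
    (P ⊗[k] K) ≃ₗ[k] (M₁ ⊗[k] K) × (M₂ ⊗[k] K) :=
  (LinearEquiv.rTensor K (LinearEquiv.ofBijective (p₁.prod p₂) h)).trans
    (TensorProduct.prodLeft k k M₁ M₂ K)

theorem tensProd_apply {k : Type} [Field k] {P M₁ M₂ : Type} (K : Type) [AddCommGroup K]
    [Module k K]
    [AddCommGroup P] [Module k P] [AddCommGroup M₁] [Module k M₁] [AddCommGroup M₂] [Module k M₂]
    (p₁ : P →ₗ[k] M₁) (p₂ : P →ₗ[k] M₂) (h : Function.Bijective (fun x => (p₁ x, p₂ x)))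
    (y : P ⊗[k] K) :
    tensProd K p₁ p₂ h y = (p₁.rTensor K y, p₂.rTensor K y) := by
  induction y with
  | zero => simp only [map_zero]; rfl
  | add a b ha hb => simp [ha, hb]
  | tmul a c => 
    simp only [tensProd, LinearEquiv.trans_apply, LinearEquiv.rTensor_tmul, LinearMap.rTensor_tmul]
    exact TensorProduct.prodLeft_tmul k k M₁ M₂ K (p₁ a) (p₂ a) c

theorem exists_equiv_prod {k : Type} [Field k] {P Q₁ Q₂ L M₁ M₂ : Type}
    [AddCommGroup P] [Module (DegV k) P] [AddCommGroup Q₁] [Module (DegV k) Q₁]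
    [AddCommGroup Q₂] [Module (DegV k) Q₂]
    [AddCommGroup L] [Module k L] [AddCommGroup M₁] [Module k M₁] [AddCommGroup M₂] [Module k M₂]
    (p₁ : P →ₗ[DegV k] Q₁) (p₂ : P →ₗ[DegV k] Q₂)
    (hp : Function.Bijective (fun x => (p₁ x, p₂ x)))
    (q₁ : L →ₗ[k] M₁) (q₂ : L →ₗ[k] M₂) (hq : Function.Bijective (fun x => (q₁ x, q₂ x)))
    (f₁ : LocalizedModule (Submonoid.powers (degT k)) Q₁ ≃+ (M₁ ⊗[k] DegK k))
    (f₂ : LocalizedModule (Submonoid.powers (degT k)) Q₂ ≃+ (M₂ ⊗[k] DegK k))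
    (hc₁ : ∀ (c : DegK k) (x : LocalizedModule (Submonoid.powers (degT k)) Q₁),
      f₁ (c • x) = LinearMap.lTensor M₁ (LinearMap.mulLeft k c) (f₁ x))
    (hc₂ : ∀ (c : DegK k) (x : LocalizedModule (Submonoid.powers (degT k)) Q₂),
      f₂ (c • x) = LinearMap.lTensor M₂ (LinearMap.mulLeft k c) (f₂ x)) :
    ∃ F : LocalizedModule (Submonoid.powers (degT k)) P ≃+ (L ⊗[k] DegK k),
      (∀ (c : DegK k) (x : LocalizedModule (Submonoid.powers (degT k)) P),
        F (c • x) = LinearMap.lTensor L (LinearMap.mulLeft k c) (F x)) ∧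
      ∀ (a : P →ₗ[DegV k] P) (a₁ : Q₁ →ₗ[DegV k] Q₁) (a₂ : Q₂ →ₗ[DegV k] Q₂)
        (b : L →ₗ[k] L) (b₁ : M₁ →ₗ[k] M₁) (b₂ : M₂ →ₗ[k] M₂),
        (∀ x, p₁ (a x) = a₁ (p₁ x)) → (∀ x, p₂ (a x) = a₂ (p₂ x)) →
        q₁ ∘ₗ b = b₁ ∘ₗ q₁ → q₂ ∘ₗ b = b₂ ∘ₗ q₂ →
        (∀ x, f₁ (LocalizedModule.map (Submonoid.powers (degT k)) a₁ x) =
          LinearMap.rTensor (DegK k) b₁ (f₁ x)) →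
        (∀ x, f₂ (LocalizedModule.map (Submonoid.powers (degT k)) a₂ x) =
          LinearMap.rTensor (DegK k) b₂ (f₂ x)) →
        ∀ x, F (LocalizedModule.map (Submonoid.powers (degT k)) a x) =
          LinearMap.rTensor (DegK k) b (F x) := by
  let S := Submonoid.powers (degT k)
  let E := AddEquiv.ofBijective _ (locProd_bijective S p₁ p₂ hp)
  let T := tensProd (DegK k) q₁ q₂ hq
  let F := E.trans ((f₁.prodCongr f₂).trans T.toAddEquiv.symm)
  have hF : ∀ x, T (F x) = (f₁ (LocalizedModule.map S p₁ x), f₂ (LocalizedModule.map S p₂ x)) :=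
    fun x => T.apply_symm_apply _
  have hF1 : ∀ x, q₁.rTensor (DegK k) (F x) = f₁ (LocalizedModule.map S p₁ x) := fun x => by
    have := hF x
    rw [tensProd_apply] at this
    exact congrArg Prod.fst this
  have hF2 : ∀ x, q₂.rTensor (DegK k) (F x) = f₂ (LocalizedModule.map S p₂ x) := fun x => by
    have := hF x
    rw [tensProd_apply] at this
    exact congrArg Prod.snd this
  refine ⟨F, ?_, ?_⟩
  · intro c x
    apply T.injective
    rw [hF, tensProd_apply]
    refine Prod.ext ?_ ?_
    · show f₁ _ = q₁.rTensor (DegK k) (LinearMap.lTensor L (LinearMap.mulLeft k c) (F x))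
      rw [← LinearMap.comp_apply (LinearMap.rTensor (DegK k) _), LinearMap.rTensor_comp_lTensor, ← LinearMap.lTensor_comp_rTensor,
        LinearMap.comp_apply, hF1, ← hc₁]
      exact congrArg f₁ ((LocalizedModule.map S p₁).map_smul c x)
    · show f₂ _ = q₂.rTensor (DegK k) (LinearMap.lTensor L (LinearMap.mulLeft k c) (F x))
      rw [← LinearMap.comp_apply (LinearMap.rTensor (DegK k) _), LinearMap.rTensor_comp_lTensor, ← LinearMap.lTensor_comp_rTensor,
        LinearMap.comp_apply, hF2, ← hc₂]
      exact congrArg f₂ ((LocalizedModule.map S p₂).map_smul c x)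
  · intro a a₁ a₂ b b₁ b₂ ha₁ ha₂ hb₁ hb₂ hr₁ hr₂ x
    apply T.injective
    rw [hF, tensProd_apply]
    refine Prod.ext ?_ ?_
    · show f₁ _ = q₁.rTensor (DegK k) (LinearMap.rTensor (DegK k) b (F x))
      rw [← LinearMap.comp_apply (LinearMap.rTensor (DegK k) q₁), ← LinearMap.rTensor_comp, hb₁, LinearMap.rTensor_comp,
        LinearMap.comp_apply, hF1, ← hr₁]
      exact congrArg f₁ (locMap_comm S p₁ _ _ ha₁ x)
    · show f₂ _ = q₂.rTensor (DegK k) (LinearMap.rTensor (DegK k) b (F x))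
      rw [← LinearMap.comp_apply (LinearMap.rTensor (DegK k) q₂), ← LinearMap.rTensor_comp, hb₂, LinearMap.rTensor_comp,
        LinearMap.comp_apply, hF2, ← hr₂]
      exact congrArg f₂ (locMap_comm S p₂ _ _ ha₂ x)

theorem degenerates_prod {k : Type} [Field k] {R : Type} [Ring R] [Algebra k R]
    {M₁ M₂ N₁ N₂ : Type} [AddCommGroup M₁] [Module R M₁] [AddCommGroup M₂] [Module R M₂]
    [AddCommGroup N₁] [Module R N₁] [AddCommGroup N₂] [Module R N₂]
    (h₁ : Degenerates k R M₁ N₁) (h₂ : Degenerates k R M₂ N₂) :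
    Degenerates k R (M₁ × M₂) (N₁ × N₂) := by
  obtain ⟨Q₁, i₁, j₁, fin₁, flat₁, ⟨e₁⟩, f₁, hc₁, hr₁⟩ := h₁
  obtain ⟨Q₂, i₂, j₂, fin₂, flat₂, ⟨e₂⟩, f₂, hc₂, hr₂⟩ := h₂
  letI v₁ := vRestrict k R Q₁
  letI v₂ := vRestrict k R Q₂
  letI m₁ : Module k M₁ := Module.compHom M₁ (algebraMap k R)
  letI m₂ : Module k M₂ := Module.compHom M₂ (algebraMap k R)
  refine ⟨Q₁ × Q₂, inferInstance, inferInstance, inferInstance, ?_, ?_, ?_⟩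
  · letI := vRestrict k R (Q₁ × Q₂)
    let p₁ : (Q₁ × Q₂) →ₗ[DegV k] Q₁ :=
      { toFun := Prod.fst, map_add' := fun _ _ => rfl, map_smul' := fun _ _ => rfl }
    let p₂ : (Q₁ × Q₂) →ₗ[DegV k] Q₂ :=
      { toFun := Prod.snd, map_add' := fun _ _ => rfl, map_smul' := fun _ _ => rfl }
    exact flat_of_prod p₁ p₂ Function.bijective_id
  · letI := rRestrict k R ((Q₁ × Q₂) ⧸ LinearMap.range (tSmul k R (Q₁ × Q₂)))
    letI := rRestrict k R (Q₁ ⧸ LinearMap.range (tSmul k R Q₁))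
    letI := rRestrict k R (Q₂ ⧸ LinearMap.range (tSmul k R Q₂))
    let π₁ := Submodule.mapQ (LinearMap.range (tSmul k R (Q₁ × Q₂)))
      (LinearMap.range (tSmul k R Q₁)) (LinearMap.fst (R ⊗[k] DegV k) Q₁ Q₂) (by
        rintro _ ⟨q, rfl⟩; exact ⟨q.1, rfl⟩)
    let π₂ := Submodule.mapQ (LinearMap.range (tSmul k R (Q₁ × Q₂)))
      (LinearMap.range (tSmul k R Q₂)) (LinearMap.snd (R ⊗[k] DegV k) Q₁ Q₂) (by
        rintro _ ⟨q, rfl⟩; exact ⟨q.2, rfl⟩)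
    let g : ((Q₁ × Q₂) ⧸ LinearMap.range (tSmul k R (Q₁ × Q₂))) →ₗ[R] N₁ × N₂ :=
      { toFun := fun x => (e₁ (π₁ x), e₂ (π₂ x))
        map_add' := fun x y => by simp
        map_smul' := fun r x => by
          refine Prod.ext ?_ ?_
          · exact (congrArg e₁ (π₁.map_smul (r ⊗ₜ[k] (1 : DegV k)) x)).trans (e₁.map_smul r (π₁ x))
          · exact (congrArg e₂ (π₂.map_smul (r ⊗ₜ[k] (1 : DegV k)) x)).trans
              (e₂.map_smul r (π₂ x)) }
    refine ⟨LinearEquiv.ofBijective g ⟨?_, ?_⟩⟩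
    · rw [injective_iff_map_eq_zero]
      intro x hx
      obtain ⟨q, rfl⟩ := Submodule.Quotient.mk_surjective _ x
      have h1 : π₁ (Submodule.Quotient.mk q) = 0 :=
        (map_eq_zero_iff e₁ e₁.injective).1 (congrArg Prod.fst hx)
      have h2 : π₂ (Submodule.Quotient.mk q) = 0 :=
        (map_eq_zero_iff e₂ e₂.injective).1 (congrArg Prod.snd hx)
      obtain ⟨a, ha⟩ := (Submodule.Quotient.mk_eq_zero _).1 h1
      obtain ⟨b, hb⟩ := (Submodule.Quotient.mk_eq_zero _).1 h2
      exact (Submodule.Quotient.mk_eq_zero _).2 ⟨(a, b), Prod.ext ha hb⟩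
    · rintro ⟨a, b⟩
      obtain ⟨a, rfl⟩ := e₁.surjective a
      obtain ⟨b, rfl⟩ := e₂.surjective b
      obtain ⟨a, rfl⟩ := Submodule.Quotient.mk_surjective _ a
      obtain ⟨b, rfl⟩ := Submodule.Quotient.mk_surjective _ b
      exact ⟨Submodule.Quotient.mk (a, b), rfl⟩
  · letI := vRestrict k R (Q₁ × Q₂)
    letI : Module k (M₁ × M₂) := Module.compHom (M₁ × M₂) (algebraMap k R)
    let p₁ : (Q₁ × Q₂) →ₗ[DegV k] Q₁ :=
      { toFun := Prod.fst, map_add' := fun _ _ => rfl, map_smul' := fun _ _ => rfl }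
    let p₂ : (Q₁ × Q₂) →ₗ[DegV k] Q₂ :=
      { toFun := Prod.snd, map_add' := fun _ _ => rfl, map_smul' := fun _ _ => rfl }
    let q₁ : (M₁ × M₂) →ₗ[k] M₁ :=
      { toFun := Prod.fst, map_add' := fun _ _ => rfl, map_smul' := fun _ _ => rfl }
    let q₂ : (M₁ × M₂) →ₗ[k] M₂ :=
      { toFun := Prod.snd, map_add' := fun _ _ => rfl, map_smul' := fun _ _ => rfl }
    obtain ⟨F, hF, hF'⟩ := exists_equiv_prod p₁ p₂ Function.bijective_id q₁ q₂
      Function.bijective_id f₁ f₂ hc₁ hc₂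
    exact ⟨F, hF, fun r => hF' (rAct k R (Q₁ × Q₂) r) (rAct k R Q₁ r) (rAct k R Q₂ r)
      (rActK k R (M₁ × M₂) r) (rActK k R M₁ r) (rActK k R M₂ r) (fun _ => rfl) (fun _ => rfl)
      rfl rfl (hr₁ r) (hr₂ r)⟩

theorem degenerates_congr {k : Type} [Field k] {R : Type} [Ring R] [Algebra k R]
    {M M' N N' : Type} [AddCommGroup M] [Module R M] [AddCommGroup M'] [Module R M']
    [AddCommGroup N] [Module R N] [AddCommGroup N'] [Module R N']
    (a : M ≃ₗ[R] M') (b : N ≃ₗ[R] N') (h : Degenerates k R M N) :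
    Degenerates k R M' N' := by
  obtain ⟨Q, i, j, fin, flat, ⟨e⟩, f, hc, hr⟩ := h
  refine ⟨Q, i, j, fin, flat, ⟨e.trans b⟩, ?_⟩
  letI := vRestrict k R Q
  letI m₁ : Module k M := Module.compHom M (algebraMap k R)
  letI m₂ : Module k M' := Module.compHom M' (algebraMap k R)
  let a' : M ≃ₗ[k] M' := { a with map_smul' := fun c m => a.map_smul (algebraMap k R c) m }
  have ha : ∀ r, a'.toLinearMap ∘ₗ rActK k R M r = rActK k R M' r ∘ₗ a'.toLinearMap := fun r => by
    ext m
    exact a.map_smul r m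
  refine ⟨f.trans (LinearEquiv.rTensor (DegK k) a').toAddEquiv, ?_, ?_⟩
  · intro c x
    show a'.toLinearMap.rTensor (DegK k) (f (c • x)) =
      LinearMap.lTensor M' (LinearMap.mulLeft k c) (a'.toLinearMap.rTensor (DegK k) (f x))
    rw [hc, ← LinearMap.comp_apply, LinearMap.rTensor_comp_lTensor,
      ← LinearMap.lTensor_comp_rTensor, LinearMap.comp_apply]
  · intro r x
    show a'.toLinearMap.rTensor (DegK k) (f _) =
      LinearMap.rTensor (DegK k) (rActK k R M' r) (a'.toLinearMap.rTensor (DegK k) (f x))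
    rw [hr, ← LinearMap.comp_apply, ← LinearMap.rTensor_comp, ha, LinearMap.rTensor_comp,
      LinearMap.comp_apply]

theorem degenerates_pow {k : Type} [Field k] {R : Type} [Ring R] [Algebra k R]
    {M N : Type} [AddCommGroup M] [Module R M] [AddCommGroup N] [Module R N]
    (h : Degenerates k R M N) (n : ℕ) (hn : 0 < n) :
    Degenerates k R (Fin n → M) (Fin n → N) := by
  induction n, hn using Nat.le_induction with
  | base =>
    exact degenerates_congr (LinearEquiv.funUnique (Fin 1) R M).symm
      (LinearEquiv.funUnique (Fin 1) R N).symm h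
  | succ n _ ih =>
    exact degenerates_congr (Fin.consLinearEquiv R (fun _ : Fin (n + 1) => M))
      (Fin.consLinearEquiv R (fun _ : Fin (n + 1) => N)) (degenerates_prod h ih)

/-- Powers of powers. -/
def powPow (R : Type) [Ring R] (M : Type) [AddCommGroup M] [Module R M] (a b : ℕ) :
    (Fin b → Fin a → M) ≃ₗ[R] (Fin (b * a) → M) :=
  (LinearEquiv.curry R M (Fin b) (Fin a)).symm.trans
    (LinearEquiv.funCongrLeft R M finProdFinEquiv.symm)

/-- Powers of products. -/
def powProd (R : Type) [Ring R] (M N : Type) [AddCommGroup M] [Module R M]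
    [AddCommGroup N] [Module R N] (n : ℕ) :
    ((Fin n → M) × (Fin n → N)) ≃ₗ[R] (Fin n → M × N) where
  toFun p i := (p.1 i, p.2 i)
  invFun f := (fun i => (f i).1, fun i => (f i).2)
  map_add' _ _ := rfl
  map_smul' _ _ := rfl
  left_inv _ := rfl
  right_inv _ := rfl

theorem degenerates_main {k : Type} [Field k] {R : Type} [Ring R] [Algebra k R]
    {M N A B : Type} [AddCommGroup M] [Module R M] [AddCommGroup N] [Module R N]
    [AddCommGroup A] [Module R A] [AddCommGroup B] [Module R B] (a b : ℕ) (ha : 0 < a) (hb : 0 < b)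
    (h₁ : Degenerates k R (Fin a → M) (Fin a → A))
    (h₂ : Degenerates k R (Fin b → N) (Fin b → B)) :
    Degenerates k R (Fin (b * a) → M × N) (Fin (b * a) → A × B) := by
  have h1 := degenerates_congr (powPow R M a b) (powPow R A a b) (degenerates_pow h₁ b hb)
  have h2 := degenerates_congr (powPow R N b a) (powPow R B b a) (degenerates_pow h₂ a ha)
  rw [mul_comm a b] at h2
  exact degenerates_congr (powProd R M N _) (powProd R A B _) (degenerates_prod h1 h2)


theorem le_moduleDepth {R : Type} [CommRing R] [IsLocalRing R] {M : Type} [AddCommGroup M]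
    [Module R M] (rs : List R) (h : ∀ r ∈ rs, r ∈ IsLocalRing.maximalIdeal R)
    (h' : RingTheory.Sequence.IsRegular M rs) : (rs.length : ℕ∞) ≤ moduleDepth R M :=
  le_sSup ⟨rs, rfl, h, h'⟩

theorem exists_of_moduleDepth {R : Type} [CommRing R] [IsLocalRing R] {M : Type} [AddCommGroup M]
    [Module R M] (n : ℕ) (h : moduleDepth R M = (n + 1 : ℕ)) :
    ∃ rs : List R, rs.length = n + 1 ∧ (∀ r ∈ rs, r ∈ IsLocalRing.maximalIdeal R) ∧
      RingTheory.Sequence.IsRegular M rs := by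
  have h1 : (n : ℕ∞) < moduleDepth R M := by
    rw [h]; exact_mod_cast Nat.lt_succ_self n
  obtain ⟨_, ⟨rs, rfl, hm, hr⟩, hlt⟩ := lt_sSup_iff.1 h1
  refine ⟨rs, ?_, hm, hr⟩
  have h2 := le_moduleDepth rs hm hr
  rw [h] at h2
  have h3 : n < rs.length := by exact_mod_cast hlt
  have h4 : rs.length ≤ n + 1 := by exact_mod_cast h2
  omega

theorem smul_top_lt_top {R : Type} [CommRing R] [IsLocalRing R] {M : Type} [AddCommGroup M]
    [Module R M] [Module.Finite R M] [Nontrivial M] :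
    IsLocalRing.maximalIdeal R • (⊤ : Submodule R M) < ⊤ :=
  (Submodule.top_ne_ideal_smul_of_le_jacobson_annihilator
    (IsLocalRing.maximalIdeal_le_jacobson _)).symm.lt_top

theorem exists_regular_prod {R : Type} [CommRing R] [IsLocalRing R] [IsNoetherianRing R]
    {A B : Type} [AddCommGroup A] [Module R A] [Module.Finite R A]
    [AddCommGroup B] [Module R B] [Module.Finite R B] (n : ℕ)
    (hA : ∃ rs : List R, rs.length = n ∧ (∀ r ∈ rs, r ∈ IsLocalRing.maximalIdeal R) ∧
      RingTheory.Sequence.IsRegular A rs)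
    (hB : ∃ rs : List R, rs.length = n ∧ (∀ r ∈ rs, r ∈ IsLocalRing.maximalIdeal R) ∧
      RingTheory.Sequence.IsRegular B rs) :
    ∃ rs : List R, rs.length = n ∧ (∀ r ∈ rs, r ∈ IsLocalRing.maximalIdeal R) ∧
      RingTheory.Sequence.IsRegular (A × B) rs := by
  have nA : Nontrivial A := by obtain ⟨_, _, _, h⟩ := hA; exact h.nontrivial
  have nB : Nontrivial B := by obtain ⟨_, _, _, h⟩ := hB; exact h.nontrivial
  have tA := (ModuleCat.exists_isRegular_tfae (IsLocalRing.maximalIdeal R) n (ModuleCat.of R A)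
    smul_top_lt_top).out 1 3
  have tB := (ModuleCat.exists_isRegular_tfae (IsLocalRing.maximalIdeal R) n (ModuleCat.of R B)
    smul_top_lt_top).out 1 3
  have tAB := (ModuleCat.exists_isRegular_tfae (IsLocalRing.maximalIdeal R) n
    (ModuleCat.of R (A × B)) smul_top_lt_top).out 1 3
  have eA := tA.2 hA
  have eB := tB.2 hB
  refine tAB.1 fun i hi => ?_
  have zero1 := AddCommGrpCat.isZero_of_iff_subsingleton.mpr (eA i hi)
  have zero2 := AddCommGrpCat.isZero_of_iff_subsingleton.mpr (eB i hi)
  let S : ShortComplex (ModuleCat.{0} R) :=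
    ShortComplex.mk (ModuleCat.ofHom (LinearMap.inl R A B)) (ModuleCat.ofHom (LinearMap.snd R A B))
      (by ext x; rfl)
  have hS : S.ShortExact :=
    { exact := (ShortComplex.ShortExact.moduleCat_exact_iff_function_exact S).2
        (Function.Exact.inl_snd)
      mono_f := (ModuleCat.mono_iff_injective _).2 LinearMap.inl_injective
      epi_g := (ModuleCat.epi_iff_surjective _).2 LinearMap.snd_surjective }
  exact AddCommGrpCat.subsingleton_of_isZero <| ShortComplex.Exact.isZero_of_both_zeros
    (Abelian.Ext.covariant_sequence_exact₂'
      (ModuleCat.of R (Shrink.{0} (R ⧸ IsLocalRing.maximalIdeal R))) hS i)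
    (zero1.eq_zero_of_src _) (zero2.eq_zero_of_tgt _)

theorem isWeaklyRegular_of_retract {R : Type} [CommRing R] (rs : List R) :
    ∀ {A P : Type} [AddCommGroup A] [Module R A] [AddCommGroup P] [Module R P]
    (i : A →ₗ[R] P) (p : P →ₗ[R] A) (_ : ∀ x, p (i x) = x)
    (_ : RingTheory.Sequence.IsWeaklyRegular P rs), RingTheory.Sequence.IsWeaklyRegular A rs := by
  induction rs with
  | nil => intros; exact .nil R _
  | cons r rs ih =>
    intro A P _ _ _ _ i p hip h
    rw [RingTheory.Sequence.isWeaklyRegular_cons_iff] at h ⊢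
    refine ⟨?_, ih (QuotSMulTop.map r i) (QuotSMulTop.map r p) ?_ h.2⟩
    · intro x y hxy
      have : i x = i y := h.1 (by simpa using congrArg i hxy)
      simpa [hip] using congrArg p this
    · intro x
      obtain ⟨x, rfl⟩ := Submodule.Quotient.mk_surjective _ x
      exact congrArg _ (hip x)

theorem moduleDepth_le_of_retract {R : Type} [CommRing R] [IsLocalRing R]
    {A P : Type} [AddCommGroup A] [Module R A] [Module.Finite R A] [Nontrivial A]
    [AddCommGroup P] [Module R P]
    (i : A →ₗ[R] P) (p : P →ₗ[R] A) (hip : ∀ x, p (i x) = x) :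
    moduleDepth R P ≤ moduleDepth R A := by
  refine sSup_le ?_
  rintro _ ⟨rs, rfl, hm, hr⟩
  exact le_moduleDepth rs hm
    (.of_isWeaklyRegular_of_mem_maximalIdeal A hm (isWeaklyRegular_of_retract rs i p hip hr.1))

theorem moduleDepth_of_subsingleton {R : Type} [CommRing R] [IsLocalRing R]
    {P : Type} [AddCommGroup P] [Module R P] [Subsingleton P] :
    moduleDepth R P = 0 := by
  refine le_antisymm (sSup_le ?_) bot_le
  rintro _ ⟨rs, rfl, hm, hr⟩
  exact absurd hr.nontrivial (not_nontrivial P)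

theorem isMCM_prod {R : Type} [CommRing R] [IsLocalRing R] [IsNoetherianRing R]
    {A B : Type} [AddCommGroup A] [Module R A] [Module.Finite R A]
    [AddCommGroup B] [Module R B] [Module.Finite R B]
    (hA : IsMCM R A) (hB : IsMCM R B) : IsMCM R (A × B) := by
  unfold IsMCM at *
  rw [← hA]
  have hAB : moduleDepth R B = moduleDepth R A := by
    have := hB.trans hA.symm
    exact_mod_cast this
  have hfin : moduleDepth R A ≠ ⊤ := by
    intro h
    rw [h] at hA
    exact ringKrullDim_ne_top (R := R) hA.symm
  congr 1
  obtain ⟨d, hd⟩ := ENat.ne_top_iff_exists.1 hfin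
  apply le_antisymm
  · rcases subsingleton_or_nontrivial A with sA | nA
    · rcases subsingleton_or_nontrivial B with sB | nB
      · rw [moduleDepth_of_subsingleton]; exact bot_le
      · rw [← hAB]
        exact moduleDepth_le_of_retract (LinearMap.inr R A B) (LinearMap.snd R A B) (fun _ => rfl)
    · exact moduleDepth_le_of_retract (LinearMap.inl R A B) (LinearMap.fst R A B) (fun _ => rfl)
  · cases d with
    | zero => rw [← hd]; exact bot_le
    | succ n =>
      obtain ⟨rs, hl, hm, hr⟩ := exists_regular_prod (n + 1) (exists_of_moduleDepth n hd.symm)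
        (exists_of_moduleDepth n (hAB.trans hd.symm))
      rw [← hd, ← hl]
      exact le_moduleDepth rs hm hr

end Helpers

/-- for maximal Cohen–Macaulay modules `A ∈ K_CM(M)` and `B ∈ K_CM(N)`,
the direct sum `A ⊕ B` belongs to `K_CM(M ⊕ N)`. -/
theorem KCM_prod_mem (k : Type) [Field k] (R : Type) [CommRing R]
    [IsNoetherianRing R] [IsLocalRing R] [Algebra k R]
    [IsAdicComplete (IsLocalRing.maximalIdeal R) R]
    (hres : Function.Bijective ⇑((IsLocalRing.residue R).comp (algebraMap k R)))
    (hCM : IsCMLocalRing R)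
    (M N A B : FGMod R)
    (hM : IsMCM R M.carrier) (hN : IsMCM R N.carrier)
    (hA : IsMCM R A.carrier) (hB : IsMCM R B.carrier)
    (hAM : A ∈ KCM k R {M}) (hBN : B ∈ KCM k R {N}) :
    FGMod.mk (A.carrier × B.carrier) ∈ KCM k R {FGMod.mk (M.carrier × N.carrier)} := by
  obtain ⟨⟨_, rfl, a, ha, h₁⟩, -⟩ := hAM
  obtain ⟨⟨_, rfl, b, hb, h₂⟩, -⟩ := hBN
  exact ⟨⟨_, rfl, b * a, Nat.mul_pos hb ha, degenerates_main a b ha hb h₁ h₂⟩, isMCM_prod hA hB⟩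
end
end

section
/- Let (R, 𝔪) be a complete Noetherian local Cohen–Macaulay ring that is a k-algebra with residue field k (k a field). The operator K_CM is a Kuratowski closure operator on CM(R); that is, for all sets 𝒳, 𝒴 of maximal Cohen–Macaulay R-modules: (1) K_CM(∅) = ∅; (2) 𝒳 ⊆ K_CM(𝒳); (3) K_CM(𝒳 ∪ 𝒴) = K_CM(𝒳) ∪ K_CM(𝒴); (4) K_CM(K_CM(𝒳)) = K_CM(𝒳). -/
open Polynomial TensorProduct

noncomputable section

/-- shift -/
def shiftF {M : Type} [Zero M] (u : ℕ → M) : ℕ → M := fun i => match i with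
  | 0 => 0
  | j+1 => u j

/-- elementary degeneration -/
def ElemDeg (R : Type) [Ring R] (M N : Type) [AddCommGroup M] [Module R M] [AddCommGroup N]
    [Module R N] : Prop :=
  ∃ (n : ℕ) (W : Submodule R ((ℕ → M) × N)),
    (∀ u y, (u, y) ∈ W → (shiftF u, (0 : N)) ∈ W) ∧
    (∀ y, ((0 : ℕ → M), y) ∈ W → y = 0) ∧
    (∀ u, (u, (0 : N)) ∈ W → ∃ w y, (w, y) ∈ W ∧ u = shiftF w) ∧
    (∀ y, ∃ u, (u, y) ∈ W) ∧
    (∀ u : ℕ → M, (∀ i < n, u i = 0) → (u, (0 : N)) ∈ W)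

section elem
variable {R : Type} [Ring R] {M N L : Type} [AddCommGroup M] [Module R M] [AddCommGroup N]
    [Module R N] [AddCommGroup L] [Module R L]

theorem ElemDeg.rfl' : ElemDeg R M M := by
  refine ⟨1, LinearMap.ker ((LinearMap.proj 0 ∘ₗ LinearMap.fst R (ℕ → M) M) - LinearMap.snd R _ _),
    ?_, ?_, ?_, ?_, ?_⟩
  · intro u y _; simp [shiftF]
  · intro y h; simpa using h
  · intro u h
    refine ⟨fun i => u (i+1), u 1, by simp, ?_⟩
    funext i
    cases i with
    | zero => simpa [shiftF] using h
    | succ j => rfl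
  · intro y; exact ⟨fun _ => y, by simp⟩
  · intro u h; simpa using h 0 (by norm_num)

theorem ElemDeg.pi (ι : Type) (h : ElemDeg R M N) : ElemDeg R (ι → M) (ι → N) := by
  obtain ⟨n, W, h1, h2, h3, h4, h5⟩ := h
  refine ⟨n, { carrier := {p | ∀ a, ((fun i => p.1 i a), p.2 a) ∈ W}
               add_mem' := fun hp hq a => W.add_mem (hp a) (hq a)
               zero_mem' := fun a => W.zero_mem
               smul_mem' := fun r p hp a => W.smul_mem r (hp a) }, ?_, ?_, ?_, ?_, ?_⟩
  · intro u y h a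
    convert h1 _ _ (h a) using 2
    · funext i; cases i <;> rfl
    · rfl
  · intro y h; funext a; exact h2 _ (h a)
  · intro u h
    choose w y hw hu using fun a => h3 _ (h a)
    refine ⟨fun i a => w a i, y, hw, ?_⟩
    funext i a
    have := congrFun (hu a) i
    simp only at this
    rw [this]; cases i <;> rfl
  · intro y
    choose u hu using fun a => h4 (y a)
    exact ⟨fun i a => u a i, hu⟩
  · intro u h a
    exact h5 _ fun i hi => congrFun (h i hi) a

theorem ElemDeg.congr {M' N' : Type} [AddCommGroup M'] [Module R M'] [AddCommGroup N']
    [Module R N'] (e : M ≃ₗ[R] M') (e' : N ≃ₗ[R] N') (h : ElemDeg R M N) : ElemDeg R M' N' := by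
  obtain ⟨n, W, h1, h2, h3, h4, h5⟩ := h
  refine ⟨n, { carrier := {p | ((fun i => e.symm (p.1 i)), e'.symm p.2) ∈ W}
               add_mem' := fun {p q} hp hq => by
                change _ ∈ W
                convert W.add_mem hp hq using 1
                ext <;> simp
               zero_mem' := by
                change _ ∈ W
                convert W.zero_mem using 1
                ext <;> simp
               smul_mem' := fun r p hp => by
                change _ ∈ W
                convert W.smul_mem r hp using 1
                ext <;> simp }, ?_, ?_, ?_, ?_, ?_⟩
  · intro u y h
    change _ ∈ W
    convert h1 _ _ h using 2
    · funext i; cases i <;> simp [shiftF]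
    · simp
  · intro y h
    have h' : ((fun _ : ℕ => e.symm 0), e'.symm y) ∈ W := h
    have := h2 (e'.symm y) (by simpa [Pi.zero_def] using h')
    simpa using this
  · intro u h
    obtain ⟨w, y, hw, hu⟩ := h3 (fun i => e.symm (u i)) (by convert h using 2; simp)
    refine ⟨fun i => e (w i), e' y, ?_, ?_⟩
    · change _ ∈ W
      simpa using hw
    · funext i
      have := congrFun hu i
      apply e.symm.injective
      rw [this]; cases i <;> simp [shiftF]
  · intro y
    obtain ⟨u, hu⟩ := h4 (e'.symm y)
    exact ⟨fun i => e (u i), by change _ ∈ W; simpa using hu⟩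
  · intro u h
    change _ ∈ W
    convert h5 (fun i => e.symm (u i)) (fun i hi => by simp [h i hi]) using 2
    simp

theorem ElemDeg.trans (hMN : ElemDeg R M N) (hNL : ElemDeg R N L) : ElemDeg R M L := by
  obtain ⟨n1, W1, a1, a2, a3, a4, a5⟩ := hMN
  obtain ⟨n2, W2, b1, b2, b3, b4, b5⟩ := hNL
  refine ⟨(n2 + 1) * n1,
   { carrier := {p | ∃ v : ℕ → N, (v, p.2) ∈ W2 ∧
        ∀ i < n2 + 1, ((fun j => p.1 (i + (n2 + 1) * j)), v i) ∈ W1}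
     add_mem' := ?_
     zero_mem' := ⟨0, W2.zero_mem, fun _ _ => W1.zero_mem⟩
     smul_mem' := ?_ }, ?_, ?_, ?_, ?_, ?_⟩
  · rintro p q ⟨v, hv, hv'⟩ ⟨w, hw, hw'⟩
    exact ⟨v + w, W2.add_mem hv hw, fun i hi => W1.add_mem (hv' i hi) (hw' i hi)⟩
  · rintro r p ⟨v, hv, hv'⟩
    exact ⟨r • v, W2.smul_mem r hv, fun i hi => W1.smul_mem r (hv' i hi)⟩
  · rintro u y ⟨v, hv, hv'⟩
    refine ⟨shiftF v, b1 _ _ hv, ?_⟩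
    intro i hi
    cases i with
    | zero =>
      suffices h : (fun j => shiftF u (0 + (n2 + 1) * j)) =
          shiftF (fun j => u (n2 + (n2 + 1) * j)) by
        exact h ▸ a1 _ _ (hv' n2 (by omega))
      funext j
      cases j with
      | zero => simp [shiftF]
      | succ j =>
        have : 0 + (n2 + 1) * (j + 1) = (n2 + (n2 + 1) * j) + 1 := by ring
        simp only [this]; rfl
    | succ i =>
      suffices h : (fun j => shiftF u (i + 1 + (n2 + 1) * j)) =
          (fun j => u (i + (n2 + 1) * j)) by
        exact h ▸ hv' i (by omega)
      funext j
      have : i + 1 + (n2 + 1) * j = (i + (n2 + 1) * j) + 1 := by ring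
      simp only [this]; rfl
  · rintro y ⟨v, hv, hv'⟩
    have hv0 : ∀ i < n2, v i = 0 := fun i hi => a2 _ (hv' i (by omega))
    have := W2.sub_mem hv (b5 v hv0)
    exact b2 _ (by simpa using this)
  · rintro u ⟨v, hv, hv'⟩
    obtain ⟨w, l, hw, rfl⟩ := b3 _ hv
    obtain ⟨x, y, hx, hx'⟩ := a3 _ (hv' 0 (by omega))
    refine ⟨fun i => u (i+1), l, ⟨Function.update w n2 y, ?_, ?_⟩, ?_⟩
    · have := W2.add_mem hw (b5 (Function.update w n2 y - w) (fun i hi => by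
        simp [Function.update_of_ne hi.ne]))
      simpa using this
    · intro i hi
      by_cases h : i = n2
      · subst h
        simp only [Function.update_self]
        convert hx using 2
        funext j
        have := congrFun hx' (j+1)
        simp only [shiftF] at this
        rw [← this]
        congr 1; ring
      · rw [Function.update_of_ne h]
        suffices h : (fun j => u (i + (n2 + 1) * j + 1)) =
            (fun j => u (i + 1 + (n2 + 1) * j)) by
          change (_, w i) ∈ W1
          exact h ▸ hv' (i+1) (by omega)
        funext j
        congr 1; ring
    · funext i
      cases i with
      | zero => simpa [shiftF] using congrFun hx' 0
      | succ j => rfl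
  · intro l
    obtain ⟨v, hv⟩ := b4 l
    choose x hx using fun i => a4 (v i)
    refine ⟨fun a => x (a % (n2+1)) (a / (n2+1)), v, hv, fun i hi => ?_⟩
    convert hx i using 2
    funext j
    simp only [Nat.add_mul_mod_self_left, Nat.mod_eq_of_lt hi]
    rw [Nat.add_mul_div_left _ _ (by omega), Nat.div_eq_of_lt hi, zero_add]
  · intro u hu
    refine ⟨0, W2.zero_mem, fun i hi => a5 _ fun j hj => hu _ ?_⟩
    nlinarith
end elem

section vfacts
variable (k : Type) [Field k]

instance : IsLocalization.AtPrime (DegV k) (tIdeal k) :=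
  inferInstanceAs (IsLocalization.AtPrime (Localization.AtPrime (tIdeal k)) (tIdeal k))

instance : IsDomain (DegV k) :=
  inferInstanceAs (IsDomain (Localization.AtPrime (tIdeal k)))

instance : IsDedekindDomain (DegV k) :=
  IsLocalization.isDedekindDomain (Polynomial k) (M := (tIdeal k).primeCompl)
    (Ideal.primeCompl_le_nonZeroDivisors _) (DegV k)

instance : Algebra.EssFiniteType k (DegV k) :=
  have := Algebra.EssFiniteType.of_isLocalization (R := Polynomial k) (S := DegV k)
    (tIdeal k).primeCompl
  Algebra.EssFiniteType.comp k (Polynomial k) (DegV k)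

instance : IsLocalization (Submonoid.powers (degT k)) (DegK k) :=
  inferInstanceAs (IsLocalization (Submonoid.powers (degT k))
    (Localization (Submonoid.powers (degT k))))

instance : IsScalarTower k (DegV k) (DegK k) :=
  inferInstanceAs (IsScalarTower k (DegV k) (Localization (Submonoid.powers (degT k))))

theorem degT_ne_zero : degT k ≠ 0 := by
  unfold degT
  have := IsLocalization.injective (M := (tIdeal k).primeCompl) (DegV k)
    (Ideal.primeCompl_le_nonZeroDivisors _)
  intro h
  exact Polynomial.X_ne_zero (this (h.trans (map_zero _).symm))

theorem VK_inj : Function.Injective (algebraMap (DegV k) (DegK k)) :=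
  IsLocalization.injective (M := Submonoid.powers (degT k)) (DegK k)
    (powers_le_nonZeroDivisors_of_noZeroDivisors (degT_ne_zero k))

theorem isUnit_ps (s : (tIdeal k).primeCompl) :
    IsUnit (Polynomial.coeToPowerSeries.ringHom (R := k) (s : Polynomial k)) := by
  have h := s.2
  rw [PowerSeries.isUnit_iff_constantCoeff, isUnit_iff_ne_zero]
  intro h0
  apply h
  change _ ∈ Ideal.span _
  rw [Ideal.mem_span_singleton, Polynomial.X_dvd_iff]
  simpa using h0

/-- expansion into power series -/
def toPS : DegV k →+* PowerSeries k :=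
  IsLocalization.lift (M := (tIdeal k).primeCompl) (isUnit_ps k)

theorem toPS_T : toPS k (degT k) = PowerSeries.X := by
  unfold toPS degT
  rw [IsLocalization.lift_eq]
  simp

theorem toPS_C (c : k) : toPS k (algebraMap k _ c) = PowerSeries.C c := by
  rw [IsScalarTower.algebraMap_apply k (Polynomial k) (DegV k)]
  unfold toPS
  rw [IsLocalization.lift_eq]
  simp

/-- coefficients -/
def vcoef (i : ℕ) : DegV k →ₗ[k] k where
  toFun v := PowerSeries.coeff i (toPS k v)
  map_add' := by simp
  map_smul' c v := by
    rw [Algebra.smul_def, map_mul, toPS_C]; simp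

theorem vcoef_T_zero (v : DegV k) : vcoef k 0 (degT k * v) = 0 := by
  simp [vcoef, toPS_T]

theorem vcoef_T_succ (i : ℕ) (v : DegV k) : vcoef k (i+1) (degT k * v) = vcoef k i v := by
  simp [vcoef, toPS_T, PowerSeries.coeff_succ_X_mul]

theorem vcoef_one (i : ℕ) : vcoef k i 1 = if i = 0 then 1 else 0 := by
  simp [vcoef, PowerSeries.coeff_one]

theorem v_decomp (v : DegV k) : ∃ w, v = algebraMap k _ (vcoef k 0 v) + degT k * w := by
  suffices h : ∀ v : DegV k, vcoef k 0 v = 0 → ∃ w, v = degT k * w by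
    obtain ⟨w, hw⟩ := h (v - algebraMap k _ (vcoef k 0 v)) (by
      rw [map_sub, Algebra.algebraMap_eq_smul_one, map_smul, vcoef_one]; simp)
    exact ⟨w, by rw [← hw]; ring⟩
  intro v hv
  obtain ⟨p, s, rfl⟩ := IsLocalization.exists_mk'_eq (tIdeal k).primeCompl v
  have h1 : IsLocalization.mk' (DegV k) p s * algebraMap (Polynomial k) _ (s : Polynomial k) = algebraMap _ _ p :=
    IsLocalization.mk'_spec _ _ _
  have h2 := congrArg (fun x => PowerSeries.coeff 0 (toPS k x)) h1
  have hp : toPS k (algebraMap _ _ p) = (p : PowerSeries k) := by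
    unfold toPS
    rw [IsLocalization.lift_eq]
    simp
  have hv' : PowerSeries.coeff 0 (toPS k (IsLocalization.mk' (DegV k) p s)) = 0 := hv
  simp only [map_mul, hp, PowerSeries.coeff_mul] at h2
  simp only [PowerSeries.coeff_zero_eq_constantCoeff] at hv'
  simp [hv'] at h2
  obtain ⟨q, rfl⟩ := Polynomial.X_dvd_iff.2 h2.symm
  refine ⟨IsLocalization.mk' _ q s, ?_⟩
  unfold degT
  rw [← IsLocalization.mul_mk'_eq_mk'_of_mul]

end vfacts

section mfacts
variable {k : Type} [Field k] {R : Type} [Ring R] [Algebra k R]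
  {M : Type} [AddCommGroup M] [Module k M] [Module R M] [IsScalarTower k R M]

/-- scalar action on right factor -/
def vm {A : Type} [CommRing A] [Algebra k A] (a : A) : M ⊗[k] A →ₗ[k] M ⊗[k] A :=
  LinearMap.lTensor M (LinearMap.mulLeft k a)

theorem vm_tmul {A : Type} [CommRing A] [Algebra k A] (a b : A) (m : M) :
    vm a (m ⊗ₜ[k] b) = m ⊗ₜ[k] (a * b) := rfl

theorem vm_mul {A : Type} [CommRing A] [Algebra k A] (a b : A) (x : M ⊗[k] A) :
    vm (a * b) x = vm a (vm b x) := by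
  induction x with
  | zero => simp
  | tmul m c => simp [vm_tmul, mul_assoc]
  | add x y hx hy => simp only [map_add, hx, hy]

theorem vm_one {A : Type} [CommRing A] [Algebra k A] (x : M ⊗[k] A) :
    vm (1 : A) x = x := by
  induction x with
  | zero => simp
  | tmul m c => simp [vm_tmul]
  | add x y hx hy => simp only [map_add, hx, hy]

theorem vm_add {A : Type} [CommRing A] [Algebra k A] (a b : A) (x : M ⊗[k] A) :
    vm (a + b) x = vm a x + vm b x := by
  induction x with
  | zero => simp
  | tmul m c => simp [vm_tmul, add_mul, TensorProduct.tmul_add]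
  | add x y hx hy => simp only [map_add, hx, hy]; abel

theorem vm_smul {A : Type} [CommRing A] [Algebra k A] (a : A) (r : R) (x : M ⊗[k] A) :
    vm a (r • x) = r • vm a x := by
  induction x with
  | zero => simp
  | tmul m c => simp [vm_tmul, TensorProduct.smul_tmul']
  | add x y hx hy => simp only [map_add, smul_add, hx, hy]

theorem vm_inj {A : Type} [CommRing A] [IsDomain A] [Algebra k A] (a : A) (ha : a ≠ 0) :
    Function.Injective (vm a : M ⊗[k] A →ₗ[k] M ⊗[k] A) :=
  Module.Flat.lTensor_preserves_injective_linearMap _ (mul_right_injective₀ ha)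

/-- M ⊗ V → M ⊗ K -/
def iotaVK : M ⊗[k] DegV k →ₗ[k] M ⊗[k] DegK k :=
  LinearMap.lTensor M (IsScalarTower.toAlgHom k (DegV k) (DegK k)).toLinearMap

theorem iotaVK_tmul (m : M) (v : DegV k) :
    iotaVK (m ⊗ₜ[k] v) = m ⊗ₜ[k] algebraMap (DegV k) (DegK k) v := rfl

theorem iotaVK_inj : Function.Injective (iotaVK : M ⊗[k] DegV k →ₗ[k] M ⊗[k] DegK k) :=
  Module.Flat.lTensor_preserves_injective_linearMap _ (VK_inj k)

theorem iotaVK_vm (v : DegV k) (x : M ⊗[k] DegV k) :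
    iotaVK (vm v x) = vm (algebraMap (DegV k) (DegK k) v) (iotaVK x) := by
  induction x with
  | zero => simp
  | tmul m c => simp [vm_tmul, iotaVK_tmul]
  | add x y hx hy => simp only [map_add, hx, hy]

theorem iotaVK_smul (r : R) (x : M ⊗[k] DegV k) :
    iotaVK (r • x) = r • iotaVK x := by
  induction x with
  | zero => simp
  | tmul m c => simp [TensorProduct.smul_tmul', iotaVK_tmul]
  | add x y hx hy => simp only [map_add, smul_add, hx, hy]

theorem exists_pow_iota (y : M ⊗[k] DegK k) :
    ∃ (a : ℕ) (x : M ⊗[k] DegV k), iotaVK x = vm (algebraMap _ _ (degT k ^ a)) y := by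
  induction y with
  | zero => exact ⟨0, 0, by simp⟩
  | tmul m c =>
    obtain ⟨v, ⟨_, a, rfl⟩, rfl⟩ := IsLocalization.exists_mk'_eq (Submonoid.powers (degT k)) c
    refine ⟨a, m ⊗ₜ v, ?_⟩
    rw [vm_tmul, iotaVK_tmul]
    congr 1
    exact (IsLocalization.mk'_spec' (DegK k) v
      (⟨_, a, rfl⟩ : Submonoid.powers (degT k))).symm
  | add x y hx hy =>
    obtain ⟨a, x', hx⟩ := hx
    obtain ⟨b, y', hy⟩ := hy
    refine ⟨a + b, vm (degT k ^ b) x' + vm (degT k ^ a) y', ?_⟩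
    simp only [map_add, iotaVK_vm, hx, hy, ← vm_mul, ← map_mul, ← pow_add]
    rw [add_comm b a]

/-- coefficient sequence -/
def cseq (x : M ⊗[k] DegV k) : ℕ → M := fun i =>
  TensorProduct.rid k M (LinearMap.lTensor M (vcoef k i) x)

theorem cseq_tmul (m : M) (v : DegV k) (i : ℕ) : cseq (m ⊗ₜ[k] v) i = vcoef k i v • m := by
  simp [cseq]

theorem cseq_add (x y : M ⊗[k] DegV k) : cseq (x + y) = cseq x + cseq y := by
  funext i; simp [cseq]

theorem cseq_zero : cseq (0 : M ⊗[k] DegV k) = 0 := by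
  funext i; simp [cseq]

theorem cseq_smul (r : R) (x : M ⊗[k] DegV k) : cseq (r • x) = r • cseq x := by
  induction x with
  | zero => simp [cseq_zero]
  | tmul m c =>
    funext i
    rw [TensorProduct.smul_tmul', Pi.smul_apply, cseq_tmul, cseq_tmul]
    exact smul_comm _ _ _
  | add x y hx hy => simp only [cseq_add, smul_add, hx, hy]

theorem shiftF_add (u v : ℕ → M) : shiftF (u + v) = shiftF u + shiftF v := by
  funext i; cases i <;> simp [shiftF]

theorem shiftF_inj {u v : ℕ → M} (h : shiftF u = shiftF v) : u = v := by
  funext i; exact congrFun h (i+1)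

theorem cseq_T (x : M ⊗[k] DegV k) : cseq (vm (degT k) x) = shiftF (cseq x) := by
  induction x with
  | zero => funext i; cases i <;> simp [cseq_zero, shiftF]
  | tmul m c =>
    funext i
    rw [vm_tmul, cseq_tmul]
    cases i with
    | zero => rw [vcoef_T_zero]; simp [shiftF]
    | succ i => rw [vcoef_T_succ]; simp [shiftF, cseq_tmul]
  | add x y hx hy => simp only [cseq_add, map_add, shiftF_add, hx, hy]

theorem decomp_T (x : M ⊗[k] DegV k) : ∃ y, x = (cseq x 0) ⊗ₜ[k] 1 + vm (degT k) y := by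
  induction x with
  | zero => exact ⟨0, by simp [cseq_zero]⟩
  | tmul m c =>
    obtain ⟨w, hw⟩ := v_decomp k c
    refine ⟨m ⊗ₜ w, ?_⟩
    rw [cseq_tmul, vm_tmul, TensorProduct.smul_tmul, ← Algebra.algebraMap_eq_smul_one,
      ← TensorProduct.tmul_add, ← hw]
  | add x y hx hy =>
    obtain ⟨a, ha⟩ := hx
    obtain ⟨b, hb⟩ := hy
    refine ⟨a + b, ?_⟩
    rw [cseq_add, Pi.add_apply, TensorProduct.add_tmul, map_add]
    nth_rewrite 1 [ha, hb]
    abel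

theorem eq_T_of_cseq (x : M ⊗[k] DegV k) (h : cseq x 0 = 0) : ∃ y, x = vm (degT k) y := by
  obtain ⟨y, hy⟩ := decomp_T x
  exact ⟨y, by rw [h] at hy; simpa using hy⟩

theorem eq_Tpow_of_cseq (n : ℕ) (x : M ⊗[k] DegV k) (h : ∀ i < n, cseq x i = 0) :
    ∃ y, x = vm (degT k ^ n) y := by
  induction n generalizing x with
  | zero => exact ⟨x, by rw [pow_zero, vm_one]⟩
  | succ n ih =>
    obtain ⟨y, rfl⟩ := eq_T_of_cseq x (h 0 (by omega))
    obtain ⟨z, rfl⟩ := ih y (fun i hi => by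
      have := h (i+1) (by omega)
      rwa [cseq_T] at this)
    exact ⟨z, by rw [pow_succ', vm_mul]⟩

/-- realise a sequence up to order n -/
theorem exists_cseq (n : ℕ) (u : ℕ → M) : ∃ x : M ⊗[k] DegV k, ∀ i < n, cseq x i = u i := by
  induction n generalizing u with
  | zero => exact ⟨0, by simp⟩
  | succ n ih =>
    obtain ⟨x, hx⟩ := ih (fun i => u (i+1))
    refine ⟨u 0 ⊗ₜ 1 + vm (degT k) x, ?_⟩
    intro i hi
    rw [cseq_add, cseq_T, Pi.add_apply, cseq_tmul, vcoef_one]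
    cases i with
    | zero => simp [shiftF]
    | succ i => simpa [shiftF] using hx i (by omega)

theorem cseq_Tpow (n : ℕ) (x : M ⊗[k] DegV k) (i : ℕ) (hi : i < n) :
    cseq (vm (degT k ^ n) x) i = 0 := by
  induction n generalizing i with
  | zero => omega
  | succ n ih =>
    rw [pow_succ', vm_mul, cseq_T]
    cases i with
    | zero => rfl
    | succ i => exact ih i (by omega)

end mfacts

section todeg

theorem rTensor_rActK {k : Type} [Field k] {R : Type} [Ring R] [Algebra k R]
    {M : Type} [AddCommGroup M] [Module R M] (r : R) :
    letI : Module k M := Module.compHom M (algebraMap k R)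
    haveI : IsScalarTower k R M := ⟨fun c r m => by
      rw [Algebra.smul_def, mul_smul]; rfl⟩
    ∀ y : M ⊗[k] DegK k, LinearMap.rTensor (DegK k) (rActK k R M r) y = r • y := by
  intro y
  let _ : Module k M := Module.compHom M (algebraMap k R)
  have : IsScalarTower k R M := ⟨fun c r m => by
      rw [Algebra.smul_def, mul_smul]; rfl⟩
  induction y with
  | zero => simp
  | tmul m c => rfl
  | add x y hx hy => simp only [map_add, smul_add, hx, hy]

variable {k : Type} [Field k] {R : Type} [Ring R] [Algebra k R]
  {M : Type} [AddCommGroup M] [Module R M] {N : Type} [AddCommGroup N] [Module R N]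

set_option maxHeartbeats 1000000 in
theorem elem_of_deg [Module.Finite R M] (h : Degenerates k R M N) : ElemDeg R M N := by
  obtain ⟨Q, iQ1, iQ2, hfin, hflat, ⟨e⟩, f, hfK, hfR⟩ := h
  let _ : Module k M := Module.compHom M (algebraMap k R)
  have : IsScalarTower k R M := ⟨fun c r m => by
    rw [Algebra.smul_def, mul_smul]; rfl⟩
  let _ := vRestrict k R Q
  have hfR' : ∀ (r : R) (x : LocalizedModule (Submonoid.powers (degT k)) Q),
      f (LocalizedModule.map (Submonoid.powers (degT k)) (rAct k R Q r) x) = r • f x :=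
    fun r x => (hfR r x).trans (rTensor_rActK r (f x))
  have hfK' : ∀ (c : DegK k) (x : LocalizedModule (Submonoid.powers (degT k)) Q),
      f (c • x) = vm c (f x) := hfK
  clear hfK hfR
  -- the map `Q → M ⊗ K`
  obtain ⟨g, hg⟩ : ∃ g : Q →+ M ⊗[k] DegK k, ∀ q, g q = f (LocalizedModule.mkLinearMap
      (Submonoid.powers (degT k)) Q q) :=
    ⟨f.toAddMonoidHom.comp (LocalizedModule.mkLinearMap
      (Submonoid.powers (degT k)) Q).toAddMonoidHom, fun q => rfl⟩
  have hsm : ∀ (v : DegV k) (x : LocalizedModule (Submonoid.powers (degT k)) Q),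
      algebraMap (DegV k) (DegK k) v • x = v • x := fun v x =>
    algebraMap_smul (Localization (Submonoid.powers (degT k))) v x
  have hgV : ∀ (v : DegV k) (q : Q), g (v • q) = vm (algebraMap (DegV k) (DegK k) v) (g q) := by
    intro v q
    rw [hg, hg, map_smul, ← hfK']
    congr 1
    exact (hsm v _).symm
  have hgR : ∀ (r : R) (q : Q), g ((r ⊗ₜ[k] (1 : DegV k)) • q) = r • g q := by
    intro r q
    rw [hg, hg, ← hfR']
    congr 1
    erw [LocalizedModule.map_mk]
    rfl
  have htv : ∀ q : Q, ((1 : R) ⊗ₜ[k] degT k) • q = degT k • q := fun q => rfl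
  have hgRV : ∀ (r : R) (v : DegV k) (q : Q),
      g ((r ⊗ₜ[k] v) • q) = r • vm (algebraMap (DegV k) (DegK k) v) (g q) := by
    intro r v q
    have : (r ⊗ₜ[k] v) = (r ⊗ₜ[k] (1 : DegV k)) * ((1 : R) ⊗ₜ[k] v) := by simp
    rw [this, mul_smul, hgR]
    congr 1
    exact hgV v q
  have hginj : Function.Injective g := by
    rw [injective_iff_map_eq_zero]
    intro q hq
    rw [hg, map_eq_zero_iff f f.injective] at hq
    obtain ⟨⟨_, n, rfl⟩, hn⟩ := (LocalizedModule.mk_eq).1 (hq.trans (LocalizedModule.zero_mk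
      (S := Submonoid.powers (degT k)) (M := Q) 1).symm)
    have hreg : IsSMulRegular Q (degT k ^ n) := Module.Flat.isSMulRegular_of_nonZeroDivisors
      (mem_nonZeroDivisors_of_ne_zero (pow_ne_zero n (degT_ne_zero k)))
    apply hreg
    simpa [Submonoid.smul_def] using hn
  have hgsurj : ∀ y, ∃ (b : ℕ) (q : Q), g q = vm (algebraMap _ _ (degT k ^ b)) y := by
    intro y
    obtain ⟨x, rfl⟩ := f.surjective y
    induction x using LocalizedModule.induction_on with
    | h q s =>
    obtain ⟨_, b, rfl⟩ := s
    refine ⟨b, q, ?_⟩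
    rw [hg, ← hfK']
    congr 1
    rw [hsm, LocalizedModule.smul'_mk]
    exact (LocalizedModule.mk_cancel (⟨_, b, rfl⟩ : Submonoid.powers (degT k)) q).symm
  clear hfK' hfR' hg
  clear f
  -- the map `Q → N`
  obtain ⟨ρ, hρR, hρ0, hρs⟩ : ∃ ρ : Q →+ N, (∀ (r : R) (q : Q),
      ρ ((r ⊗ₜ[k] (1 : DegV k)) • q) = r • ρ q) ∧ (∀ q, ρ q = 0 ↔ ∃ q', q = degT k • q') ∧
      Function.Surjective ρ := by
    let _ := rRestrict k R (Q ⧸ LinearMap.range (tSmul k R Q))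
    refine ⟨e.toLinearMap.toAddMonoidHom.comp
      (LinearMap.range (tSmul k R Q)).mkQ.toAddMonoidHom, ?_, ?_, ?_⟩
    · intro r q
      exact e.map_smul r (Submodule.Quotient.mk q)
    · intro q
      change e (Submodule.Quotient.mk q) = 0 ↔ _
      rw [e.map_eq_zero_iff, Submodule.Quotient.mk_eq_zero]
      constructor
      · rintro ⟨q', rfl⟩; exact ⟨q', rfl⟩
      · rintro ⟨q', rfl⟩; exact ⟨q', rfl⟩
    · intro y
      obtain ⟨x, rfl⟩ := e.surjective y
      obtain ⟨q, rfl⟩ := Submodule.Quotient.mk_surjective _ x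
      exact ⟨q, rfl⟩
  clear e
  -- uniform bound `a`
  have key : ∀ q, ∃ a, ∃ x : M ⊗[k] DegV k, iotaVK x = vm (algebraMap _ _ (degT k ^ a)) (g q) :=
    fun q => exists_pow_iota (g q)
  have hup : ∀ q a b, a ≤ b → (∃ x : M ⊗[k] DegV k, iotaVK x =
      vm (algebraMap _ _ (degT k ^ a)) (g q)) → ∃ x : M ⊗[k] DegV k, iotaVK x =
      vm (algebraMap _ _ (degT k ^ b)) (g q) := by
    rintro q a b hab ⟨x, hx⟩
    obtain ⟨c, rfl⟩ := Nat.exists_eq_add_of_le' hab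
    exact ⟨vm (degT k ^ c) x, by rw [iotaVK_vm, hx, ← vm_mul, ← map_mul, ← pow_add]⟩
  obtain ⟨a, ha⟩ : ∃ a, ∀ q, ∃ x : M ⊗[k] DegV k,
      iotaVK x = vm (algebraMap _ _ (degT k ^ a)) (g q) := by
    obtain ⟨s, hs⟩ := hfin.fg_top
    choose A hA using key
    refine ⟨s.sup A, fun q => ?_⟩
    have hq : q ∈ Submodule.span (R ⊗[k] DegV k) (s : Set Q) := hs ▸ Submodule.mem_top
    induction hq using Submodule.span_induction with
    | mem q hq => exact hup q _ _ (Finset.le_sup hq) (hA q)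
    | zero => exact ⟨0, by simp⟩
    | add q q' _ _ h1 h2 =>
      obtain ⟨x, hx⟩ := h1
      obtain ⟨y, hy⟩ := h2
      exact ⟨x + y, by simp only [map_add, hx, hy]⟩
    | smul z q _ h1 =>
      obtain ⟨x, hx⟩ := h1
      induction z with
      | zero => exact ⟨0, by simp⟩
      | tmul r v =>
        refine ⟨r • vm v x, ?_⟩
        rw [hgRV, iotaVK_smul, iotaVK_vm, hx, vm_smul, ← vm_mul, ← vm_mul, mul_comm]
      | add z z' h1 h2 =>
        obtain ⟨x, hx⟩ := h1
        obtain ⟨y, hy⟩ := h2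
        exact ⟨x + y, by simp only [add_smul, map_add, hx, hy]⟩
  clear key hup
  -- uniform bound `b`
  obtain ⟨b, hb⟩ : ∃ b, ∀ x : M ⊗[k] DegV k, ∃ q, vm (algebraMap _ _ (degT k ^ a)) (g q) =
      iotaVK (vm (degT k ^ b) x) := by
    obtain ⟨s, hs⟩ := (inferInstance : Module.Finite R M).fg_top
    have key : ∀ m : M, ∃ b, ∃ q, g q = iotaVK (vm (degT k ^ b) (m ⊗ₜ[k] (1 : DegV k))) := by
      intro m
      obtain ⟨b, q, h⟩ := hgsurj (iotaVK (m ⊗ₜ[k] (1 : DegV k)))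
      exact ⟨b, q, by rw [iotaVK_vm, h]⟩
    choose B hB using key
    suffices h : ∀ x : M ⊗[k] DegV k, ∃ q, g q = iotaVK (vm (degT k ^ (s.sup B)) x) by
      refine ⟨s.sup B + a, fun x => ?_⟩
      obtain ⟨q, hq⟩ := h x
      exact ⟨q, by rw [hq, ← iotaVK_vm, ← vm_mul, ← pow_add, add_comm]⟩
    intro x
    induction x with
    | zero => exact ⟨0, by simp⟩
    | add x y h1 h2 =>
      obtain ⟨q, h1⟩ := h1
      obtain ⟨q', h2⟩ := h2
      exact ⟨q + q', by simp only [map_add, h1, h2]⟩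
    | tmul m v =>
      suffices h : ∃ q, g q = iotaVK (vm (degT k ^ (s.sup B)) (m ⊗ₜ[k] (1 : DegV k))) by
        obtain ⟨q, h⟩ := h
        exact ⟨v • q, by
          rw [hgV, h, ← iotaVK_vm, vm_tmul, vm_tmul, vm_tmul]
          congr 2; ring⟩
      have hm : m ∈ Submodule.span R (s : Set M) := hs ▸ Submodule.mem_top
      induction hm using Submodule.span_induction with
      | mem m hm =>
        obtain ⟨q, hq⟩ := hB m
        obtain ⟨c, hc⟩ := Nat.exists_eq_add_of_le' (Finset.le_sup (f := B) hm)
        exact ⟨degT k ^ c • q, by rw [hgV, hq, ← iotaVK_vm, ← vm_mul, ← pow_add, hc]⟩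
      | zero => exact ⟨0, by simp⟩
      | add m m' _ _ h1 h2 =>
        obtain ⟨q, h1⟩ := h1
        obtain ⟨q', h2⟩ := h2
        exact ⟨q + q', by simp only [TensorProduct.add_tmul, map_add, h1, h2]⟩
      | smul r m _ h1 =>
        obtain ⟨q, h1⟩ := h1
        exact ⟨(r ⊗ₜ[k] (1 : DegV k)) • q, by
          rw [hgR, h1, ← TensorProduct.smul_tmul', vm_smul, iotaVK_smul]⟩
  -- injectivity of `x ↦ t^a x` composed with g
  have hT : ∀ q q', vm (algebraMap (DegV k) (DegK k) (degT k ^ a)) (g q) =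
      vm (algebraMap _ _ (degT k ^ a)) (g q') → q = q' := by
    intro q q' h
    rw [← hgV, ← hgV] at h
    have hreg : IsSMulRegular Q (degT k ^ a) := Module.Flat.isSMulRegular_of_nonZeroDivisors
      (mem_nonZeroDivisors_of_ne_zero (pow_ne_zero a (degT_ne_zero k)))
    exact hreg (hginj h)
  have hcomm : ∀ (v : DegV k) q, vm (algebraMap (DegV k) (DegK k) (degT k ^ a)) (g (v • q)) =
      vm (algebraMap _ _ v) (vm (algebraMap _ _ (degT k ^ a)) (g q)) := by
    intro v q
    rw [hgV, ← vm_mul, ← vm_mul, mul_comm]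
  -- if x has coefficients vanishing below b+1 then q in tQ
  have hvan : ∀ q (x : M ⊗[k] DegV k), iotaVK x = vm (algebraMap _ _ (degT k ^ a)) (g q) →
      (∀ i < b + 1, cseq x i = 0) → ρ q = 0 := by
    intro q x hx hi
    obtain ⟨y, rfl⟩ := eq_Tpow_of_cseq _ _ hi
    obtain ⟨q', hq'⟩ := hb y
    rw [hρ0]
    refine ⟨q', hT _ _ ?_⟩
    rw [hcomm, hq', ← hx, ← iotaVK_vm, ← vm_mul, pow_succ']
  have hvan' : ∀ u : ℕ → M, (∀ i < b, u i = 0) → ∃ q, ∃ x : M ⊗[k] DegV k, iotaVK x = vm (algebraMap _ _ (degT k ^ a)) (g q) ∧ ∀ i < b + 1, u i = cseq x i := by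
    intro u hu
    obtain ⟨x, hx⟩ := exists_cseq (k := k) (b+1) u
    obtain ⟨y, rfl⟩ := eq_Tpow_of_cseq b x (fun i hi => by rw [hx i (by omega), hu i hi])
    obtain ⟨q, hq⟩ := hb y
    exact ⟨q, _, hq.symm, fun i hi => (hx i hi).symm⟩
  refine ⟨b + 1, { carrier := {p | ∃ q, ∃ x : M ⊗[k] DegV k, ρ q = p.2 ∧
              iotaVK x = vm (algebraMap _ _ (degT k ^ a)) (g q) ∧ ∀ i < b + 1, p.1 i = cseq x i}
                   add_mem' := ?_
                   zero_mem' := ⟨0, 0, by simp, by simp, by simp [cseq_zero]⟩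
                   smul_mem' := ?_}, ?_, ?_, ?_, ?_, ?_⟩
  · rintro p p' ⟨q, x, h1, h2, h3⟩ ⟨q', x', h1', h2', h3'⟩
    refine ⟨q + q', x + x', by simp [h1, h1'], by simp only [map_add, h2, h2'], ?_⟩
    intro i hi
    simp [cseq_add, h3 i hi, h3' i hi]
  · rintro r p ⟨q, x, h1, h2, h3⟩
    refine ⟨(r ⊗ₜ[k] (1 : DegV k)) • q, r • x, by simp [hρR, h1],
      by rw [iotaVK_smul, hgR, h2, vm_smul], ?_⟩
    intro i hi
    simp [cseq_smul, h3 i hi]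
  · rintro u y ⟨q, x, h1, h2, h3⟩
    refine ⟨degT k • q, vm (degT k) x, (hρ0 _).2 ⟨q, rfl⟩, by rw [hcomm, iotaVK_vm, h2], ?_⟩
    intro i hi
    rw [cseq_T]
    cases i with
    | zero => rfl
    | succ i => exact h3 i (by omega)
  · rintro y ⟨q, x, h1, h2, h3⟩
    exact h1.symm.trans (hvan q x h2 fun i hi => (h3 i hi).symm)
  · rintro u ⟨q, x, h1, h2, h3⟩
    obtain ⟨q', rfl⟩ := (hρ0 _).1 h1
    obtain ⟨x', hx'⟩ := ha q'
    have hxx : x = vm (degT k) x' := iotaVK_inj (by rw [h2, hcomm, iotaVK_vm, hx'])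
    subst hxx
    obtain ⟨q'', x'', g1, g2⟩ := hvan' (fun i => u (i+1) - cseq x' i) (fun i hi => by
      have := h3 (i+1) (by omega)
      rw [cseq_T] at this
      exact sub_eq_zero.2 this)
    refine ⟨fun i => u (i+1), ρ (q' + q''), ⟨q' + q'', x' + x'', rfl,
      by simp only [map_add, hx', g1], ?_⟩, ?_⟩
    · intro i hi
      rw [cseq_add, Pi.add_apply, ← g2 i hi]
      simp
    · funext i
      cases i with
      | zero => 
        have := h3 0 (by omega)
        rwa [cseq_T] at this
      | succ i => rfl
  · intro y
    obtain ⟨q, rfl⟩ := hρs y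
    obtain ⟨x, hx⟩ := ha q
    exact ⟨cseq x, q, x, rfl, hx, fun _ _ => rfl⟩
  · intro u hu
    obtain ⟨q, x, h1, h2⟩ := hvan' u (fun i hi => hu i (by omega))
    exact ⟨q, x, hvan q x h1 (fun i hi => by rw [← h2 i hi, hu i hi]), h1, h2⟩

end todeg

section fromdeg

section act
variable (k : Type) [Field k] (R : Type) [Ring R] [Algebra k R]
  (M : Type) [AddCommGroup M] [Module k M] [Module R M] [IsScalarTower k R M]

/-- action of `R ⊗ V` on `M ⊗ V` -/
def mvAct : R ⊗[k] DegV k →ₐ[k] Module.End k (M ⊗[k] DegV k) :=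
  (Module.endTensorEndAlgHom (R := k) (S := k) (A := k) (M := M) (N := DegV k)).comp
    (Algebra.TensorProduct.map (Algebra.lsmul k k M) (Algebra.lmul k (DegV k)))

/-- `M ⊗ V` as a module over `R ⊗ V` -/
@[reducible] def mvModule : Module (R ⊗[k] DegV k) (M ⊗[k] DegV k) :=
  Module.compHom _ (mvAct k R M).toRingHom

theorem mvAct_tmul (r : R) (v : DegV k) (x : M ⊗[k] DegV k) :
    mvAct k R M (r ⊗ₜ v) x = r • vm v x := by
  induction x with
  | zero => simp
  | tmul m w => rfl
  | add x y hx hy => simp only [map_add, smul_add, hx, hy]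

theorem vm_algebraMap {k R M : Type} [Field k] [Ring R] [Algebra k R] [AddCommGroup M]
    [Module k M] [Module R M] [IsScalarTower k R M] (c : k) (x : M ⊗[k] DegV k) :
    vm (algebraMap k (DegV k) c) x = algebraMap k R c • x := by
  induction x with
  | zero => simp
  | tmul m v =>
    rw [vm_tmul, ← Algebra.smul_def, TensorProduct.smul_tmul', algebraMap_smul,
      TensorProduct.smul_tmul]
  | add x y hx hy => simp only [map_add, smul_add, hx, hy]

/-- `M ⊗ A` as a module over `A` -/
@[reducible] def raModule (A : Type) [CommRing A] [Algebra k A] : Module A (M ⊗[k] A) where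
  smul a x := vm a x
  one_smul := vm_one
  mul_smul := vm_mul
  smul_zero a := map_zero _
  smul_add a := map_add _
  add_smul := vm_add
  zero_smul x := by
    have h := vm_add (0 : A) 0 x
    rw [add_zero] at h
    exact left_eq_add.1 h

end act

variable {k : Type} [Field k] {R : Type} [CommRing R] [IsNoetherianRing R] [Algebra k R]
  {M : Type} [AddCommGroup M] [Module R M] {N : Type} [AddCommGroup N] [Module R N]

theorem noeth_RV : IsNoetherianRing (R ⊗[k] DegV k) :=
  Algebra.EssFiniteType.isNoetherianRing R (R ⊗[k] DegV k)

set_option maxHeartbeats 1000000 in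
theorem deg_of_elem [Module.Finite R M] (h : ElemDeg R M N) : Degenerates k R M N := by
  obtain ⟨n, W, h1, h2, h3, h4, h5⟩ := h
  let _ : Module k M := Module.compHom M (algebraMap k R)
  have : IsScalarTower k R M := ⟨fun c r m => by
    rw [Algebra.smul_def, mul_smul]; rfl⟩
  let _ := mvModule k R M
  have hact : ∀ (r : R) (v : DegV k) (x : M ⊗[k] DegV k), (r ⊗ₜ[k] v) • x = r • vm v x :=
    mvAct_tmul k R M
  have hV : ∀ (j : ℕ) (v : DegV k) (x : M ⊗[k] DegV k), (∀ i < n - j, cseq x i = 0) →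
      (∃ y, (cseq x, y) ∈ W) → ∃ y, (cseq (vm v x), y) ∈ W := by
    intro j
    induction j with
    | zero =>
      intro v x hx _
      obtain ⟨y, rfl⟩ := eq_Tpow_of_cseq _ _ hx
      refine ⟨0, h5 _ fun i hi => ?_⟩
      rw [← vm_mul, mul_comm, vm_mul]
      exact cseq_Tpow _ _ _ hi
    | succ j ih =>
      rintro v x hx ⟨y, hy⟩
      obtain ⟨w, hw⟩ := v_decomp k v
      obtain ⟨z, hz⟩ := ih w (vm (degT k) x) (fun i hi => by
        rw [cseq_T]
        cases i with
        | zero => rfl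
        | succ i => exact hx i (by omega)) ⟨0, by rw [cseq_T]; exact h1 _ _ hy⟩
      refine ⟨algebraMap k R (vcoef k 0 v) • y + z, ?_⟩
      convert W.add_mem (W.smul_mem (algebraMap k R (vcoef k 0 v)) hy) hz using 1
      rw [Prod.smul_mk, Prod.mk_add_mk, ← cseq_smul, ← cseq_add]
      congr 2
      rw [← vm_mul]
      nth_rewrite 1 [hw]
      rw [vm_add, mul_comm w]
      congr 1
      exact vm_algebraMap _ _
  let Q : Submodule (R ⊗[k] DegV k) (M ⊗[k] DegV k) :=
    { carrier := {x | ∃ y, (cseq x, y) ∈ W}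
      add_mem' := by
        rintro x x' ⟨y, hy⟩ ⟨y', hy'⟩
        exact ⟨y + y', by rw [cseq_add]; exact W.add_mem hy hy'⟩
      zero_mem' := ⟨0, by rw [cseq_zero]; exact W.zero_mem⟩
      smul_mem' := by
        intro z x hx
        induction z with
        | zero => rw [zero_smul]; exact ⟨0, by rw [cseq_zero]; exact W.zero_mem⟩
        | tmul r v =>
          obtain ⟨y, hy⟩ := hV n v x (by simp) hx
          exact ⟨r • y, by rw [hact, cseq_smul]; exact W.smul_mem r hy⟩
        | add z z' h h' =>
          obtain ⟨y, hy⟩ := h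
          obtain ⟨y', hy'⟩ := h'
          exact ⟨y + y', by rw [add_smul, cseq_add]; exact W.add_mem hy hy'⟩ }
  have hQ : ∀ x, x ∈ Q ↔ ∃ y, (cseq x, y) ∈ W := fun x => Iff.rfl
  clear_value Q
  refine ⟨Q, inferInstance, inferInstance, ?_, ?_, ?_, ?_⟩
  · have := noeth_RV (k := k) (R := R)
    have : Module.Finite (R ⊗[k] DegV k) (M ⊗[k] DegV k) := by
      obtain ⟨s, hs⟩ := (inferInstance : Module.Finite R M).fg_top
      classical
      refine ⟨s.image (fun m => m ⊗ₜ 1), ?_⟩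
      rw [eq_top_iff]
      rintro x -
      induction x with
      | zero => exact Submodule.zero_mem _
      | add x y hx hy => exact Submodule.add_mem _ hx hy
      | tmul m v =>
        have hm : m ∈ Submodule.span R (s : Set M) := hs ▸ Submodule.mem_top
        induction hm using Submodule.span_induction with
        | mem m hm =>
          have : m ⊗ₜ[k] v = ((1 : R) ⊗ₜ[k] v) • (m ⊗ₜ[k] (1 : DegV k)) := by
            rw [hact, vm_tmul]; simp
          rw [this]
          refine Submodule.smul_mem _ _ (Submodule.subset_span ?_)
          simpa using ⟨m, hm, rfl⟩
        | zero => rw [TensorProduct.zero_tmul]; exact Submodule.zero_mem _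
        | add m m' _ _ hx hy => rw [TensorProduct.add_tmul]; exact Submodule.add_mem _ hx hy
        | smul r m _ hx =>
          have : (r • m) ⊗ₜ[k] v = (r ⊗ₜ[k] (1 : DegV k)) • (m ⊗ₜ[k] v) := by
            rw [hact, vm_one, TensorProduct.smul_tmul']
          rw [this]
          exact Submodule.smul_mem _ _ hx
    infer_instance
  · let _ := vRestrict k R Q
    have : Module.IsTorsionFree (DegV k) Q := by
      refine ⟨fun v hv => ?_⟩
      intro x y hxy
      have hxy' : ((1 : R) ⊗ₜ[k] v) • (x : M ⊗[k] DegV k) = ((1 : R) ⊗ₜ[k] v) • (y : M ⊗[k] DegV k) :=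
        congrArg Subtype.val hxy
      rw [hact, hact, one_smul, one_smul] at hxy'
      exact Subtype.ext (vm_inj v hv.ne_zero hxy')
    infer_instance
  · choose p hp using fun x : Q => (hQ x).1 x.2
    have huniq : ∀ u y y', (u, y) ∈ W → (u, y') ∈ W → y = y' := by
      intro u y y' h h'
      have := W.sub_mem h h'
      rw [Prod.mk_sub_mk, sub_self] at this
      exact sub_eq_zero.1 (h2 _ this)
    let P : Q →+ N :=
      { toFun := p
        map_zero' := huniq _ _ _ (hp 0) (by
          change (cseq 0, _) ∈ W
          rw [cseq_zero]; exact W.zero_mem)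
        map_add' := fun x y => huniq _ _ _ (hp (x + y)) (by
          change (cseq (x.1 + y.1), _) ∈ W
          rw [cseq_add]; exact W.add_mem (hp x) (hp y)) }
    have hPt : ∀ x : Q, P (tSmul k R Q x) = 0 := by
      intro x
      refine huniq _ _ _ (hp _) ?_
      change (cseq (((1 : R) ⊗ₜ[k] degT k) • x.1), _) ∈ W
      rw [hact, one_smul, cseq_T]
      exact h1 _ _ (hp x)
    have hPk : ∀ x : Q, P x = 0 → ∃ y : Q, tSmul k R Q y = x := by
      intro x hx
      have hx' := hp x
      change p x = 0 at hx
      rw [hx] at hx'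
      obtain ⟨w, y, hw, hxw⟩ := h3 _ hx'
      obtain ⟨z, hz⟩ := eq_T_of_cseq x.1 (by rw [hxw]; rfl)
      have hzw : cseq z = w := shiftF_inj (by rw [← hxw, hz, cseq_T])
      refine ⟨⟨z, (hQ z).2 ⟨y, by rw [hzw]; exact hw⟩⟩, ?_⟩
      apply Subtype.ext
      change ((1 : R) ⊗ₜ[k] degT k) • z = _
      rw [hact, one_smul, hz]
    have hPs : Function.Surjective P := by
      intro y
      obtain ⟨u, hu⟩ := h4 y
      obtain ⟨x, hx⟩ := exists_cseq (k := k) n u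
      have hxW : (cseq x, y) ∈ W := by
        have := W.add_mem (h5 (cseq x - u) (fun i hi => by simp [hx i hi])) hu
        simpa using this
      exact ⟨⟨x, (hQ x).2 ⟨y, hxW⟩⟩, huniq _ _ _ (hp _) hxW⟩
    have hPR : ∀ (r : R) (x : Q), P ((r ⊗ₜ[k] (1 : DegV k)) • x) = r • P x := by
      intro r x
      refine huniq _ _ _ (hp _) ?_
      change (cseq ((r ⊗ₜ[k] (1 : DegV k)) • x.1), _) ∈ W
      rw [hact, vm_one, cseq_smul]
      exact W.smul_mem r (hp x)
    let PP : (Q ⧸ LinearMap.range (tSmul k R Q)) →+ N :=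
      QuotientAddGroup.lift (LinearMap.range (tSmul k R Q)).toAddSubgroup P (by
        rintro _ ⟨x, rfl⟩; exact hPt x)
    have hPP : ∀ x : Q, PP (Submodule.Quotient.mk x) = P x := fun x => rfl
    let _ := rRestrict k R (Q ⧸ LinearMap.range (tSmul k R Q))
    refine ⟨LinearEquiv.ofBijective { PP with map_smul' := ?_ } ⟨?_, ?_⟩⟩
    · intro r x
      obtain ⟨x, rfl⟩ := Submodule.Quotient.mk_surjective _ x
      exact hPR r x
    · change Function.Injective PP
      rw [injective_iff_map_eq_zero]
      intro x hx
      obtain ⟨x, rfl⟩ := Submodule.Quotient.mk_surjective _ x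
      obtain ⟨y, rfl⟩ := hPk x hx
      rw [Submodule.Quotient.mk_eq_zero]
      exact ⟨y, rfl⟩
    · intro y
      obtain ⟨x, rfl⟩ := hPs y
      exact ⟨Submodule.Quotient.mk x, rfl⟩
  · let _ := vRestrict k R Q
    let iK := raModule k M (DegK k)
    let iV : Module (DegV k) (M ⊗[k] DegK k) := Module.compHom _ (algebraMap (DegV k) (DegK k))
    have : IsScalarTower (DegV k) (DegK k) (M ⊗[k] DegK k) := ⟨fun a b x => by
      rw [Algebra.smul_def, mul_smul]; rfl⟩
    have hsK : ∀ (c : DegK k) (x : M ⊗[k] DegK k), c • x = vm c x := fun _ _ => rfl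
    have hsV : ∀ (c : DegV k) (x : M ⊗[k] DegK k), c • x = vm (algebraMap _ (DegK k) c) x :=
      fun _ _ => rfl
    have hsQ : ∀ (c : DegV k) (x : Q), (c • x).1 = vm c x.1 := fun c x => by
      change ((1 : R) ⊗ₜ[k] c) • x.1 = _
      rw [hact, one_smul]
    let l : Q →ₗ[DegV k] M ⊗[k] DegK k :=
      { toFun := fun x => iotaVK x.1
        map_add' := fun x y => map_add iotaVK x.1 y.1
        map_smul' := fun v x => by
          rw [hsQ, iotaVK_vm]; rfl }
    have hunit : ∀ x : Submonoid.powers (degT k),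
        IsUnit (algebraMap (DegV k) (Module.End (DegV k) (M ⊗[k] DegK k)) x) := by
      intro s
      have := IsLocalization.map_units (DegK k) s
      obtain ⟨u, hu⟩ := this
      rw [Module.End.isUnit_iff]
      constructor
      · intro x y hxy
        have hxy' : vm (algebraMap _ (DegK k) (s : DegV k)) x
          = vm (algebraMap _ (DegK k) (s : DegV k)) y := hxy
        rw [← hu] at hxy'
        have := congrArg (vm (↑u⁻¹ : DegK k)) hxy'
        rwa [← vm_mul, ← vm_mul, Units.inv_mul, vm_one, vm_one] at this
      · intro x
        refine ⟨vm (↑u⁻¹ : DegK k) x, ?_⟩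
        change vm (algebraMap _ (DegK k) (s : DegV k)) _ = _
        rw [← hu, ← vm_mul, Units.mul_inv, vm_one]
    have hl : IsLocalizedModule (Submonoid.powers (degT k)) l := by
      refine ⟨hunit, ?_, ?_⟩
      · intro y
        obtain ⟨a, x, hx⟩ := exists_pow_iota y
        refine ⟨⟨⟨vm (degT k ^ n) x, (hQ _).2 ⟨0, h5 _ fun i hi => cseq_Tpow _ _ _ hi⟩⟩,
          ⟨degT k ^ (n + a), _, rfl⟩⟩, ?_⟩
        change vm (algebraMap _ (DegK k) (degT k ^ (n + a))) y = iotaVK (vm (degT k ^ n) x)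
        rw [iotaVK_vm, hx, ← vm_mul, ← map_mul, ← pow_add]
      · intro x y hxy
        exact ⟨1, by rw [Subtype.ext (iotaVK_inj hxy)]⟩
    let F := IsLocalizedModule.iso (Submonoid.powers (degT k)) l
    refine ⟨F.toAddEquiv, ?_, ?_⟩
    · intro c x
      change F (c • x) = vm c (F x)
      have : IsScalarTower (DegV k) (DegK k) (LocalizedModule (Submonoid.powers (degT k)) Q) :=
        inferInstanceAs (IsScalarTower (DegV k) (Localization (Submonoid.powers (degT k)))
          (LocalizedModule (Submonoid.powers (degT k)) Q))
      exact (F.toLinearMap.extendScalarsOfIsLocalization (Submonoid.powers (degT k)) (DegK k)).map_smul c x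
    · intro r x
      refine Eq.trans ?_ (rTensor_rActK r (F x)).symm
      let rr : M ⊗[k] DegK k →ₗ[DegV k] M ⊗[k] DegK k :=
        { toFun := fun x => r • x
          map_add' := smul_add r
          map_smul' := fun v x => (vm_smul (algebraMap _ (DegK k) v) r x).symm }
      have key : F.toLinearMap ∘ₗ (LocalizedModule.map (Submonoid.powers (degT k)) (rAct k R Q r))
          = rr ∘ₗ F.toLinearMap := by
        apply IsLocalizedModule.ext (Submonoid.powers (degT k))
          (LocalizedModule.mkLinearMap (Submonoid.powers (degT k)) Q) hunit
        ext q
        have e1 : LocalizedModule.map (Submonoid.powers (degT k)) (rAct k R Q r)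
          (LocalizedModule.mkLinearMap (Submonoid.powers (degT k)) Q q) =
          LocalizedModule.mkLinearMap (Submonoid.powers (degT k)) Q (rAct k R Q r q) := by
          erw [LocalizedModule.map_mk]
          rfl
        have e2 : ∀ q, F (LocalizedModule.mkLinearMap (Submonoid.powers (degT k)) Q q) = l q :=
          fun q => by
            simp [F, IsLocalizedModule.iso_apply_mk]
        change F _ = r • F _
        refine (congrArg F e1).trans ?_
        rw [e2, e2]
        change iotaVK ((r ⊗ₜ[k] (1 : DegV k)) • q.1) = r • iotaVK q.1
        rw [hact, vm_one, iotaVK_smul]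
      exact LinearMap.congr_fun key x

end fromdeg

/-- flatten a double power -/
def piFlat {R M α β γ : Type} [Ring R] [AddCommGroup M] [Module R M] (e : γ ≃ α × β) :
    (α → β → M) ≃ₗ[R] (γ → M) :=
  (LinearEquiv.curry R M α β).symm ≪≫ₗ LinearEquiv.funCongrLeft R M e

/-- `K_CM` is a Kuratowski closure operator on `CM(R)`. -/
theorem KCM_isKuratowskiClosure (k : Type) [Field k] (R : Type) [CommRing R]
    [IsNoetherianRing R] [IsLocalRing R] [Algebra k R]
    [IsAdicComplete (IsLocalRing.maximalIdeal R) R]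
    (hres : Function.Bijective ⇑((IsLocalRing.residue R).comp (algebraMap k R)))
    (hCM : IsCMLocalRing R) :
    KCM k R (∅ : Set (FGMod R)) = ∅ ∧
    (∀ X : Set (FGMod R), X ⊆ {L : FGMod R | IsMCM R L.carrier} → X ⊆ KCM k R X) ∧
    (∀ X Y : Set (FGMod R), X ⊆ {L : FGMod R | IsMCM R L.carrier} →
      Y ⊆ {L : FGMod R | IsMCM R L.carrier} →
      KCM k R (X ∪ Y) = KCM k R X ∪ KCM k R Y) ∧
    (∀ X : Set (FGMod R), X ⊆ {L : FGMod R | IsMCM R L.carrier} →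
      KCM k R (KCM k R X) = KCM k R X) := by
  have hrefl : ∀ X : Set (FGMod R), X ⊆ {L : FGMod R | IsMCM R L.carrier} → X ⊆ KCM k R X :=
    fun X hX M hM => ⟨⟨M, hM, 1, one_pos, deg_of_elem ElemDeg.rfl'⟩, hX hM⟩
  refine ⟨?_, hrefl, ?_, ?_⟩
  · ext N
    constructor
    · rintro ⟨⟨M, hM, _⟩, _⟩
      exact hM.elim
    · intro h
      exact h.elim
  · intro X Y _ _
    ext N
    constructor
    · rintro ⟨⟨M, hM | hM, h⟩, hN⟩
      · exact Or.inl ⟨⟨M, hM, h⟩, hN⟩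
      · exact Or.inr ⟨⟨M, hM, h⟩, hN⟩
    · rintro (⟨⟨M, hM, h⟩, hN⟩ | ⟨⟨M, hM, h⟩, hN⟩)
      · exact ⟨⟨M, Or.inl hM, h⟩, hN⟩
      · exact ⟨⟨M, Or.inr hM, h⟩, hN⟩
  · intro X hX
    apply Set.Subset.antisymm
    · rintro L ⟨⟨N, ⟨⟨M, hM, n, hn, hMN⟩, _⟩, p, hp, hNL⟩, hL⟩
      refine ⟨⟨M, hM, p * n, Nat.mul_pos hp hn, deg_of_elem ?_⟩, hL⟩
      have h1 := (ElemDeg.pi (Fin p) (elem_of_deg hMN)).congr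
        (piFlat finProdFinEquiv.symm) (piFlat finProdFinEquiv.symm)
      have h2 := (ElemDeg.pi (Fin n) (elem_of_deg hNL)).congr
        (piFlat (finProdFinEquiv.symm.trans (Equiv.prodComm _ _)))
        (piFlat (finProdFinEquiv.symm.trans (Equiv.prodComm _ _)))
      exact h1.trans h2
    · exact hrefl _ (fun N hN => hN.2)
end
end

section
/- Let k be a field and R = k[[x,y]]/(x^2), and let (x) denote the ideal of R generated by the residue class of x. Then there is a short exact sequence 0 → (x) → R → (x) → 0 of R-modules, and consequently R ⇒_deg (x) ⊕ (x). -/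
open Polynomial TensorProduct

noncomputable section

/-- The ring `R = k[[x,y]]/(x²)`. -/
abbrev AinfRing (k : Type) [Field k] : Type :=
  MvPowerSeries (Fin 2) k ⧸ Ideal.span {(MvPowerSeries.X (0 : Fin 2) : MvPowerSeries (Fin 2) k) ^ 2}

/-- The residue class of `x` in `R = k[[x,y]]/(x²)`. -/
def ax (k : Type) [Field k] : AinfRing k := Ideal.Quotient.mk _ ((MvPowerSeries.X (0 : Fin 2) : MvPowerSeries (Fin 2) k))

/-- The residue class of `y` in `R = k[[x,y]]/(x²)`. -/
def ay (k : Type) [Field k] : AinfRing k := Ideal.Quotient.mk _ ((MvPowerSeries.X (1 : Fin 2) : MvPowerSeries (Fin 2) k))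

/-- The ideal `(x)` of `R = k[[x,y]]/(x²)`. -/
def xIdeal (k : Type) [Field k] : Ideal (AinfRing k) := Ideal.span {ax k}

section helpers

variable (k : Type) [Field k]

instance degV_isLocalization : IsLocalization (tIdeal k).primeCompl (DegV k) :=
  inferInstanceAs (IsLocalization (tIdeal k).primeCompl (Localization.AtPrime (tIdeal k)))

instance degV_isDomain : IsDomain (DegV k) :=
  inferInstanceAs (IsDomain (Localization.AtPrime (tIdeal k)))

instance degV_isDedekind : IsDedekindDomain (DegV k) :=
  inferInstanceAs (IsDedekindDomain (Localization.AtPrime (tIdeal k)))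

instance degK_isLocalization : IsLocalization (Submonoid.powers (degT k)) (DegK k) :=
  inferInstanceAs (IsLocalization (Submonoid.powers (degT k))
    (Localization (Submonoid.powers (degT k))))

instance degK_tower : IsScalarTower k (DegV k) (DegK k) :=
  inferInstanceAs (IsScalarTower k (DegV k) (Localization (Submonoid.powers (degT k))))

theorem mem_tIdeal_iff (p : Polynomial k) : p ∈ tIdeal k ↔ p.eval 0 = 0 := by
  rw [tIdeal, Ideal.mem_span_singleton, Polynomial.X_dvd_iff, Polynomial.coeff_zero_eq_eval_zero]

/-- evaluation at `t = 0`. -/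
def resV : DegV k →ₐ[k] k :=
  IsLocalization.liftAlgHom (M := (tIdeal k).primeCompl) (f := Polynomial.aeval (0 : k))
    (fun y => by
      have h := y.2
      rw [Ideal.mem_primeCompl_iff, mem_tIdeal_iff] at h
      rw [← Polynomial.coeff_zero_eq_eval_zero] at h
      simpa [Polynomial.aeval_def] using h)

theorem resV_t : resV k (degT k) = 0 := by
  simp [resV, degT]

theorem V_decomp (v : DegV k) : ∃ (c : k) (w : DegV k), v = algebraMap k (DegV k) c + degT k * w := by
  obtain ⟨⟨p, s⟩, h⟩ := IsLocalization.surj (tIdeal k).primeCompl v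
  have hs := s.2
  rw [Ideal.mem_primeCompl_iff, mem_tIdeal_iff] at hs
  set c := p.eval 0 / (s : Polynomial k).eval 0 with hc
  have hp : p - Polynomial.C c * s ∈ tIdeal k := by
    rw [mem_tIdeal_iff]; simp [hc, hs]
  obtain ⟨q, hq⟩ := Ideal.mem_span_singleton.1 (show p - Polynomial.C c * s ∈ Ideal.span {Polynomial.X} from hp)
  have hu := IsLocalization.map_units (DegV k) s
  refine ⟨c, IsLocalization.mk' (DegV k) q s, ?_⟩
  apply hu.mul_right_cancel
  have h1 : degT k * IsLocalization.mk' (DegV k) q s * algebraMap (Polynomial k) (DegV k) s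
      = algebraMap (Polynomial k) (DegV k) (Polynomial.X * q) := by
    rw [mul_assoc, IsLocalization.mk'_spec, map_mul]; rfl
  simp only at h
  rw [h, add_mul, h1, ← hq, IsScalarTower.algebraMap_apply k (Polynomial k) (DegV k),
    ← map_mul, ← map_add]
  congr 1
  simp [Polynomial.algebraMap_eq]

variable (R : Type) [CommRing R] [Algebra k R]

theorem A_regular (v : DegV k) (hv : v ≠ 0) (a : R ⊗[k] DegV k)
    (h : ((1 : R) ⊗ₜ[k] v) * a = 0) : a = 0 := by
  have hinj : Function.Injective (LinearMap.lTensor R (LinearMap.mulLeft k v)) :=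
    Module.Flat.lTensor_preserves_injective_linearMap _ (mul_right_injective₀ hv)
  apply hinj
  rw [map_zero, ← h]
  clear h
  induction a with
  | zero => simp
  | tmul a w => simp
  | add x y hx hy => simp [mul_add, hx, hy]

/-- evaluation at `t = 0`. -/
def resA : R ⊗[k] DegV k →ₐ[R] R :=
  Algebra.TensorProduct.lift (AlgHom.id R R) ((Algebra.ofId k R).comp (resV k))
    (fun _ _ => Commute.all _ _)

theorem resA_tmul (r : R) (v : DegV k) : resA k R (r ⊗ₜ v) = r * algebraMap k R (resV k v) := by
  simp [resA, Algebra.ofId_apply]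

theorem resA_t : resA k R (1 ⊗ₜ degT k) = 0 := by
  rw [resA_tmul, resV_t]; simp

theorem A_decomp (a : R ⊗[k] DegV k) :
    ∃ (b : R ⊗[k] DegV k), a = (resA k R a) ⊗ₜ 1 + (1 ⊗ₜ degT k) * b := by
  induction a with
  | zero => exact ⟨0, by simp⟩
  | tmul r v =>
    obtain ⟨c, w, h⟩ := V_decomp k v
    refine ⟨r ⊗ₜ w, ?_⟩
    rw [resA_tmul, h]
    simp only [map_add, map_mul, resV_t, AlgHom.commutes, zero_mul, add_zero,
      Algebra.TensorProduct.tmul_mul_tmul, one_mul, Algebra.algebraMap_self, RingHom.id_apply]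
    rw [TensorProduct.tmul_add, Algebra.algebraMap_eq_smul_one c, TensorProduct.tmul_smul,
      TensorProduct.smul_tmul', Algebra.smul_def, mul_comm r]
  | add x y hx hy =>
    obtain ⟨b, hb⟩ := hx
    obtain ⟨c, hc⟩ := hy
    refine ⟨b + c, ?_⟩
    rw [map_add, TensorProduct.add_tmul, mul_add]
    nth_rewrite 1 [hb, hc]
    abel

/-- The ideal `(x, t)`. -/
abbrev Qid (x : R) : Ideal (R ⊗[k] DegV k) :=
  Ideal.span {x ⊗ₜ 1, 1 ⊗ₜ degT k}

theorem Q_flat (x : R) :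
    letI := vRestrict k R (Qid k R x); Module.Flat (DegV k) (Qid k R x) := by
  letI := vRestrict k R (Qid k R x)
  have : Module.IsTorsionFree (DegV k) (Qid k R x) := by
    constructor
    intro v hv q q' h
    have hv0 : v ≠ 0 := hv.ne_zero
    have h' : ((1 : R) ⊗ₜ[k] v) * (q : R ⊗[k] DegV k) = ((1 : R) ⊗ₜ[k] v) * q' :=
      congrArg Subtype.val h
    ext
    rw [← sub_eq_zero]
    apply A_regular k R v hv0
    rw [mul_sub, h', sub_self]
  infer_instance

theorem Q_mod (x : R) (hx : ∀ r, x * r = 0 ↔ x ∣ r) :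
    letI := rRestrict k R (Qid k R x ⧸ LinearMap.range (tSmul k R (Qid k R x)))
    Nonempty ((Qid k R x ⧸ LinearMap.range (tSmul k R (Qid k R x))) ≃ₗ[R]
      (Ideal.span {x} × Ideal.span {x} : Type)) := by
  letI := rRestrict k R (Qid k R x ⧸ LinearMap.range (tSmul k R (Qid k R x)))
  let xA : R ⊗[k] DegV k := x ⊗ₜ 1
  let tA : R ⊗[k] DegV k := 1 ⊗ₜ degT k
  have hxx : x * x = 0 := (hx x).2 dvd_rfl
  have hxxA : xA * xA = 0 := by simp [xA, hxx]
  have rx : resA k R xA = x := by simp [xA, resA_tmul]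
  have rt : resA k R tA = 0 := resA_t k R
  have hxm : xA ∈ Qid k R x := Ideal.subset_span (by simp [xA])
  have htm : tA ∈ Qid k R x := Ideal.subset_span (by simp [tA])
  let xQ : Qid k R x := ⟨xA, hxm⟩
  let tQ : Qid k R x := ⟨tA, htm⟩
  have hspan : ∀ q : Qid k R x, ∃ a b : R ⊗[k] DegV k, q = a • xQ + b • tQ := by
    rintro ⟨q, hq⟩
    obtain ⟨a, b, h⟩ := Ideal.mem_span_pair.1 hq
    exact ⟨a, b, Subtype.ext h.symm⟩
  let pr := (LinearMap.range (tSmul k R (Qid k R x))).mkQ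
  let φ : ((R ⊗[k] DegV k) × (R ⊗[k] DegV k)) →ₗ[R]
      (Qid k R x ⧸ LinearMap.range (tSmul k R (Qid k R x))) :=
    { toFun := fun p => pr (p.1 • xQ + p.2 • tQ)
      map_add' := fun p q => by
        rw [← map_add]; congr 1
        simp only [Prod.fst_add, Prod.snd_add, add_smul]; abel
      map_smul' := fun r p => by
        have : pr ((r • p).1 • xQ + (r • p).2 • tQ) =
            (r ⊗ₜ[k] (1 : DegV k)) • pr (p.1 • xQ + p.2 • tQ) := by
          rw [← map_smul]; congr 1
          rw [smul_add, ← mul_smul, ← mul_smul, Prod.smul_fst, Prod.smul_snd,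
            Algebra.smul_def, Algebra.smul_def]
          rfl
        exact this }
  have hφ : Function.Surjective φ := by
    intro q
    obtain ⟨q, rfl⟩ := Submodule.mkQ_surjective _ q
    obtain ⟨a, b, rfl⟩ := hspan q
    exact ⟨(a, b), rfl⟩
  let m : R →ₗ[R] Ideal.span {x} :=
    (LinearMap.mulLeft R x).codRestrict (Ideal.span {x})
      (fun r => Ideal.mem_span_singleton.2 (dvd_mul_right x r))
  have hm : Function.Surjective m := by
    rintro ⟨y, hy⟩
    obtain ⟨r, rfl⟩ := Ideal.mem_span_singleton.1 hy
    exact ⟨r, rfl⟩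
  have hm0 : ∀ r, m r = 0 ↔ x * r = 0 := fun r => by
    rw [Subtype.ext_iff]; rfl
  have hres : Function.Surjective (resA k R) := fun r => ⟨r ⊗ₜ 1, by simp [resA_tmul]⟩
  let ψ : ((R ⊗[k] DegV k) × (R ⊗[k] DegV k)) →ₗ[R] (Ideal.span {x} × Ideal.span {x} : Type) :=
    LinearMap.prodMap (m ∘ₗ (resA k R).toLinearMap) (m ∘ₗ (resA k R).toLinearMap)
  have hψ : Function.Surjective ψ := by
    have := hm.comp hres
    exact this.prodMap this
  have key : ∀ a, x * resA k R a = 0 → ∃ e f, a = xA * e + tA * f := by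
    intro a ha
    obtain ⟨s, hs⟩ := (hx _).1 ha
    obtain ⟨f, hf⟩ := A_decomp k R a
    refine ⟨s ⊗ₜ 1, f, ?_⟩
    rw [hf, hs]; simp [xA, tA]
  have hker : LinearMap.ker φ = LinearMap.ker ψ := by
    ext ⟨a, b⟩
    have e1 : (a, b) ∈ LinearMap.ker φ ↔ ∃ c d, a * xA + b * tA = tA * (c * xA + d * tA) := by
      rw [LinearMap.mem_ker]
      change (Submodule.mkQ _) (a • xQ + b • tQ) = 0 ↔ _
      rw [Submodule.mkQ_apply, Submodule.Quotient.mk_eq_zero]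
      constructor
      · rintro ⟨q, hq⟩
        obtain ⟨c, d, rfl⟩ := hspan q
        exact ⟨c, d, (congrArg Subtype.val hq).symm⟩
      · rintro ⟨c, d, h⟩
        exact ⟨c • xQ + d • tQ, Subtype.ext h.symm⟩
    have e2 : (a, b) ∈ LinearMap.ker ψ ↔ x * resA k R a = 0 ∧ x * resA k R b = 0 := by
      rw [LinearMap.mem_ker, ← hm0, ← hm0]
      exact Prod.ext_iff
    rw [e1, e2]
    constructor
    · rintro ⟨c, d, h⟩
      have ha : x * resA k R a = 0 := by
        have := congrArg (resA k R) h
        simpa [rx, rt, mul_comm] using this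
      refine ⟨ha, ?_⟩
      obtain ⟨e, f, rfl⟩ := key a ha
      have h2 : xA * f + b - (c * xA + d * tA) = 0 := by
        apply A_regular k R _ (degT_ne_zero k)
        change tA * _ = 0
        linear_combination h - e * hxxA
      have h3 : xA * b = xA * d * tA := by
        linear_combination xA * h2 + (c - f) * hxxA
      have := congrArg (resA k R) h3
      simpa [rx, rt] using this
    · rintro ⟨ha, hb⟩
      obtain ⟨e, f, rfl⟩ := key a ha
      obtain ⟨e', f', rfl⟩ := key b hb
      exact ⟨f + e', f', by linear_combination e * hxxA⟩
  exact ⟨(φ.quotKerEquivOfSurjective hφ).symm ≪≫ₗ Submodule.quotEquivOfEq _ _ hker ≪≫ₗ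
    ψ.quotKerEquivOfSurjective hψ⟩

/-- the map `R ⊗ V → R ⊗ K`. -/
def toAK : R ⊗[k] DegV k →ₐ[k] R ⊗[k] DegK k :=
  Algebra.TensorProduct.map (AlgHom.id k R) (IsScalarTower.toAlgHom k (DegV k) (DegK k))

theorem toAK_inj : Function.Injective (toAK k R) := by
  have hi : Function.Injective (algebraMap (DegV k) (DegK k)) :=
    IsLocalization.injective (DegK k)
      (powers_le_nonZeroDivisors_of_noZeroDivisors (degT_ne_zero k))
  exact Module.Flat.lTensor_preserves_injective_linearMap (M := R)
    (IsScalarTower.toAlgHom k (DegV k) (DegK k)).toLinearMap hi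

theorem lT_eq (c : DegK k) (z : R ⊗[k] DegK k) :
    LinearMap.lTensor R (LinearMap.mulLeft k c) z = (1 ⊗ₜ c) * z := by
  induction z with
  | zero => simp
  | tmul a w => simp
  | add x y hx hy => simp [mul_add, hx, hy]

theorem rT_eq (L : R →ₗ[k] R) (r : R) (hL : ∀ m, L m = r * m) (z : R ⊗[k] DegK k) :
    LinearMap.rTensor (DegK k) L z = (r ⊗ₜ 1) * z := by
  induction z with
  | zero => simp
  | tmul a w => simp [hL]
  | add x y hx hy => simp [mul_add, hx, hy]

theorem Q_loc' (x : R) (L : R → R →ₗ[k] R) (hL : ∀ r m, L r m = r * m) :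
    letI := vRestrict k R (Qid k R x)
    ∃ f : LocalizedModule (Submonoid.powers (degT k)) (Qid k R x) ≃+ (R ⊗[k] DegK k),
       (∀ (c : DegK k) (z : LocalizedModule (Submonoid.powers (degT k)) (Qid k R x)),
          f (c • z) = LinearMap.lTensor R (LinearMap.mulLeft k c) (f z)) ∧
       (∀ (r : R) (z : LocalizedModule (Submonoid.powers (degT k)) (Qid k R x)),
          f (LocalizedModule.map (Submonoid.powers (degT k)) (rAct k R (Qid k R x) r) z)
            = LinearMap.rTensor (DegK k) (L r) (f z)) := by
  letI := vRestrict k R (Qid k R x)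
  letI mK : Module (DegK k) (R ⊗[k] DegK k) := Module.compHom _
    ((Algebra.TensorProduct.includeRight : DegK k →ₐ[k] R ⊗[k] DegK k) : DegK k →+* R ⊗[k] DegK k)
  letI mV : Module (DegV k) (R ⊗[k] DegK k) := Module.compHom _ (algebraMap (DegV k) (DegK k))
  have smulK : ∀ (c : DegK k) (z : R ⊗[k] DegK k), c • z = (1 ⊗ₜ c) * z := fun _ _ => rfl
  have smulV : ∀ (c : DegV k) (z : R ⊗[k] DegK k), c • z = algebraMap (DegV k) (DegK k) c • z :=
    fun _ _ => rfl
  haveI tow : IsScalarTower (DegV k) (DegK k) (R ⊗[k] DegK k) :=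
    IsScalarTower.of_algebraMap_smul (fun _ _ => rfl)
  have toAKV : ∀ v : DegV k, toAK k R (1 ⊗ₜ v) = 1 ⊗ₜ algebraMap (DegV k) (DegK k) v := by
    intro v; simp [toAK]
  let g : Qid k R x →ₗ[DegV k] R ⊗[k] DegK k :=
    { toFun := fun q => toAK k R q
      map_add' := fun p q => by simp
      map_smul' := fun v q => by
        change toAK k R ((1 ⊗ₜ v) * (q : R ⊗[k] DegV k)) = (1 ⊗ₜ algebraMap (DegV k) (DegK k) v) * _
        rw [map_mul, toAKV] }
  have gapp : ∀ q, g q = toAK k R (q : R ⊗[k] DegV k) := fun _ => rfl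
  have hu : ∀ s : Submonoid.powers (degT k), IsUnit (algebraMap (DegV k) (DegK k) s) :=
    IsLocalization.map_units (DegK k)
  have hsurj : ∀ y : R ⊗[k] DegK k, ∃ (n : ℕ) (a : R ⊗[k] DegV k),
      (degT k ^ n) • y = toAK k R a := by
    intro y
    induction y with
    | zero => exact ⟨0, 0, by simp⟩
    | tmul r c =>
      obtain ⟨⟨v, ⟨_, n, rfl⟩⟩, h⟩ := IsLocalization.surj (Submonoid.powers (degT k)) c
      refine ⟨n, r ⊗ₜ v, ?_⟩
      rw [smulV, smulK]
      simp only at h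
      simp [toAK, ← h, mul_comm]
    | add y z hy hz =>
      obtain ⟨n, a, ha⟩ := hy
      obtain ⟨m, b, hb⟩ := hz
      refine ⟨n + m, (1 ⊗ₜ (degT k ^ m)) * a + (1 ⊗ₜ (degT k ^ n)) * b, ?_⟩
      rw [map_add, map_mul, map_mul, ← ha, ← hb, toAKV, toAKV, ← smulK, ← smulK, ← smulV, ← smulV,
        ← mul_smul, ← mul_smul, ← pow_add, ← pow_add, smul_add, add_comm m n]
  haveI : IsLocalizedModule (Submonoid.powers (degT k)) g :=
    { map_units := fun s => by
        rw [Module.End.isUnit_iff]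
        obtain ⟨u, hu⟩ := hu s
        have : ⇑(algebraMap (DegV k) (Module.End (DegV k) (R ⊗[k] DegK k)) s)
            = fun z => u • z := by
          funext z
          rw [Module.algebraMap_end_apply, smulV, ← hu]; rfl
        rw [this]
        exact MulAction.bijective u
      surj := fun y => by
        obtain ⟨n, a, h⟩ := hsurj y
        refine ⟨(⟨(1 ⊗ₜ degT k) * a, Ideal.mul_mem_right _ _ (Ideal.subset_span (by simp))⟩,
          ⟨degT k ^ (n + 1), n + 1, rfl⟩), ?_⟩
        rw [gapp, Submonoid.smul_def, map_mul, ← h, toAKV, ← smulK, ← smulV, ← mul_smul]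
        simp only [pow_succ']
      exists_of_eq := fun {a b} h => ⟨1, by
        rw [Subtype.ext (toAK_inj k R h)]⟩ }
  let F := IsLocalizedModule.iso (Submonoid.powers (degT k)) g
  have hF : ∀ q, F (LocalizedModule.mkLinearMap _ _ q) = g q := fun q => by
    simp [F]
  refine ⟨F.toAddEquiv, ?_, ?_⟩
  · intro c z
    rw [lT_eq, ← smulK]
    haveI : IsScalarTower (DegV k) (DegK k) (LocalizedModule (Submonoid.powers (degT k)) (Qid k R x)) :=
      inferInstanceAs (IsScalarTower (DegV k) (Localization (Submonoid.powers (degT k)))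
        (LocalizedModule (Submonoid.powers (degT k)) (Qid k R x)))
    exact (F.toLinearMap.extendScalarsOfIsLocalization
      (Submonoid.powers (degT k)) (DegK k)).map_smul c z
  · intro r z
    rw [rT_eq k R (L r) r (hL r)]
    let G : R ⊗[k] DegK k →ₗ[DegV k] R ⊗[k] DegK k :=
      { toFun := fun z => (r ⊗ₜ 1) * z
        map_add' := mul_add _
        map_smul' := fun v z => by
          simp only [smulV, smulK, RingHom.id_apply]; ring }
    have : F.toLinearMap ∘ₗ LocalizedModule.map (Submonoid.powers (degT k))
        (rAct k R (Qid k R x) r) = G ∘ₗ F.toLinearMap := by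
      apply IsLocalizedModule.linearMap_ext (Submonoid.powers (degT k))
        (LocalizedModule.mkLinearMap (Submonoid.powers (degT k)) (Qid k R x)) g
      ext q
      have e : LocalizedModule.map (Submonoid.powers (degT k)) (rAct k R (Qid k R x) r)
          (LocalizedModule.mkLinearMap _ _ q) =
          LocalizedModule.mkLinearMap _ _ (rAct k R (Qid k R x) r q) := by
        simp [LocalizedModule.map_mk]
      change F (LocalizedModule.map (Submonoid.powers (degT k)) (rAct k R (Qid k R x) r)
          (LocalizedModule.mkLinearMap _ _ q)) = G (F (LocalizedModule.mkLinearMap _ _ q))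
      rw [e, hF, hF, gapp, gapp]
      change toAK k R ((r ⊗ₜ 1) * (q : R ⊗[k] DegV k)) = (r ⊗ₜ 1) * _
      rw [map_mul]
      simp [toAK]
    exact LinearMap.congr_fun this z

theorem Q_loc (x : R) (inst : Module k R) (hinst : inst = Algebra.toModule)
    (L : R → R →ₗ[k] R) (hL : ∀ r m, L r m = r * m) :
    letI := vRestrict k R (Qid k R x)
    ∃ f : LocalizedModule (Submonoid.powers (degT k)) (Qid k R x) ≃+ (R ⊗[k] DegK k),
       (∀ (c : DegK k) (z : LocalizedModule (Submonoid.powers (degT k)) (Qid k R x)),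
          f (c • z) = LinearMap.lTensor R (LinearMap.mulLeft k c) (f z)) ∧
       (∀ (r : R) (z : LocalizedModule (Submonoid.powers (degT k)) (Qid k R x)),
          f (LocalizedModule.map (Submonoid.powers (degT k)) (rAct k R (Qid k R x) r) z)
            = LinearMap.rTensor (DegK k) (L r) (f z)) := by
  subst hinst
  exact Q_loc' k R x L hL

theorem degenerates_of_ann (x : R) (hx : ∀ r, x * r = 0 ↔ x ∣ r) :
    Degenerates k R R (Ideal.span {x} × Ideal.span {x} : Type) := by
  refine ⟨Qid k R x, inferInstance, inferInstance, ?_, Q_flat k R x, Q_mod k R x hx, ?_⟩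
  · exact Module.Finite.iff_fg.2 (Submodule.fg_span (Set.toFinite _))
  · refine Q_loc k R x (Module.compHom R (algebraMap k R)) ?_ (rActK k R R) (fun _ _ => rfl)
    ext c r
    exact (Algebra.smul_def c r).symm

theorem ax_ann (r : AinfRing k) : ax k * r = 0 ↔ ax k ∣ r := by
  have hx2 : ax k * ax k = 0 := by
    rw [ax, ← map_mul, Ideal.Quotient.eq_zero_iff_mem, ← pow_two]
    exact Ideal.mem_span_singleton_self _
  constructor
  · intro h
    obtain ⟨p, rfl⟩ := Ideal.Quotient.mk_surjective r
    rw [ax, ← map_mul, Ideal.Quotient.eq_zero_iff_mem, Ideal.mem_span_singleton, pow_two] at h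
    have hX : (MvPowerSeries.X (0 : Fin 2) : MvPowerSeries (Fin 2) k) ≠ 0 := by
      intro h0
      have := congrArg (MvPowerSeries.coeff (Finsupp.single (0 : Fin 2) 1)) h0
      simp [MvPowerSeries.coeff_X] at this
    exact map_dvd _ ((mul_dvd_mul_iff_left hX).1 h)
  · rintro ⟨s, rfl⟩
    rw [← mul_assoc, hx2, zero_mul]

end helpers

/-- there is a short exact sequence `0 → (x) → R → (x) → 0`, and
consequently `R ⇒_deg (x) ⊕ (x)`, over `R = k[[x,y]]/(x²)`. -/
theorem xIdeal_ses_and_degeneration (k : Type) [Field k] :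
    (∃ (f : ↥(xIdeal k) →ₗ[AinfRing k] AinfRing k)
       (g : AinfRing k →ₗ[AinfRing k] ↥(xIdeal k)),
       Function.Injective ⇑f ∧ Function.Surjective ⇑g ∧
       LinearMap.range f = LinearMap.ker g) ∧
    Degenerates k (AinfRing k) (AinfRing k) (↥(xIdeal k) × ↥(xIdeal k)) := by
  refine ⟨⟨(xIdeal k).subtype, (LinearMap.mulLeft (AinfRing k) (ax k)).codRestrict (xIdeal k)
      (fun r => Ideal.mem_span_singleton.2 (dvd_mul_right _ r)), Subtype.val_injective, ?_, ?_⟩,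
    degenerates_of_ann k (AinfRing k) (ax k) (ax_ann k)⟩
  · rintro ⟨y, hy⟩
    obtain ⟨r, rfl⟩ := Ideal.mem_span_singleton.1 hy
    exact ⟨r, rfl⟩
  · rw [Submodule.range_subtype]
    ext r
    rw [LinearMap.mem_ker]
    refine Iff.trans Ideal.mem_span_singleton (Iff.trans (ax_ann k r).symm ?_)
    exact (Subtype.ext_iff (a1 := (⟨ax k * r, Ideal.mem_span_singleton.2 (dvd_mul_right _ r)⟩ :
      xIdeal k)) (a2 := 0)).symm
end
end
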